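/- For any $\alpha>0$ there exists $n_0$ such that for all $n\ge n_0$ the following holds. Let $G_1,\dots,G_{2n}$ be graphs on the common vertex set $[n]$, each with minimum degree at least $(2/3+\alpha)n$. Then there is a copy of the square of a Hamilton cycle on $[n]$ in $\bigcup_i G_i$ together with a bijection $\phi$ from its $2n$ edges to $[2n]$ such that each edge $e$ satisfies $e\in E(G_{\phi(e)})$. -/

import Mathlib

open scoped Classical

namespace Posa

/-- every three consecutive entries of the list satisfy `T` -/
def Valid {α : Type} (T : α → α → α → Prop) : List α → Prop
  | a :: b :: c :: l => T a b c ∧ Valid T (b :: c :: l)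
  | _ => True

lemma valid_append {α : Type} (T : α → α → α → Prop) (p : List α) (a b : α) (q : List α) :
    Valid T (p ++ a :: b :: q) ↔ Valid T (p ++ [a, b]) ∧ Valid T (a :: b :: q) := by
  induction p with
  | nil => simp [Valid]
  | cons x p ih =>
    cases p with
    | nil => cases q <;> simp [Valid]
    | cons y p =>
      cases p with
      | nil =>
        simp only [List.cons_append, List.nil_append, Valid] at ih ⊢
        tauto
      | cons z p =>
        simp only [List.cons_append, Valid] at ih ⊢
        tauto

lemma valid_get {α : Type} (T : α → α → α → Prop) (l : List α) :
    Valid T l ↔ ∀ i (h : i + 2 < l.length), T l[i] l[i + 1] l[i + 2] := by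
  induction l with
  | nil => simp [Valid]
  | cons x p ih =>
    cases p with
    | nil => simp [Valid]
    | cons y p =>
      cases p with
      | nil => simp [Valid]
      | cons z p =>
        simp only [Valid, ih]
        constructor
        · rintro ⟨h1, h2⟩ i hi
          cases i with
          | zero => simpa using h1
          | succ i => exact h2 i (by simpa using hi)
        · intro h
          refine ⟨by simpa using h 0 (by simp), fun i hi => ?_⟩
          have := h (i + 1) (by simpa using hi)
          simpa using this

lemma erdos_step (δ : ℝ) (hδ : 0 < δ) (t : ℕ) : ∃ N0 : ℕ, ∃ δ' : ℝ, 0 < δ' ∧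
    ∀ (X Z : Type) [Fintype X] [Fintype Z] (R : X → Z → Prop), N0 ≤ Fintype.card X →
      δ * Fintype.card X * Fintype.card Z ≤
        ∑ x : X, ((Finset.univ.filter (fun z => R x z)).card : ℝ) →
      ∃ T : Finset X, T.card = t ∧
        δ' * Fintype.card Z ≤ ((Finset.univ.filter (fun z => ∀ x ∈ T, R x z)).card : ℝ) := by
  obtain ⟨M, hM⟩ := exists_nat_ge (4 * (t + 1) / δ)
  obtain ⟨N0, hN0⟩ := exists_nat_ge (2 * (M + 1) / δ)
  refine ⟨max N0 t, δ / 4 / 2 ^ M, by positivity, ?_⟩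
  intro X Z _ _ R hX hsum
  rw [div_le_iff₀ hδ] at hM hN0
  have hXN : N0 ≤ Fintype.card X := le_trans (le_max_left _ _) hX
  have hXt : t ≤ Fintype.card X := le_trans (le_max_right _ _) hX
  rcases Nat.eq_zero_or_pos (Fintype.card Z) with hz | hz
  · obtain ⟨T, -, hT⟩ := Finset.exists_subset_card_eq (s := (Finset.univ : Finset X)) (n := t)
      (by simpa using hXt)
    refine ⟨T, hT, ?_⟩
    rw [hz]; simp
  have hz' : (0 : ℝ) < Fintype.card Z := by exact_mod_cast hz
  set H : Finset X := Finset.univ.filter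
    (fun x => δ / 2 * Fintype.card Z ≤ ((Finset.univ.filter (fun z => R x z)).card : ℝ)) with hH
  have h1 : ∑ x : X, ((Finset.univ.filter (fun z => R x z)).card : ℝ) ≤
      ∑ x : X, ((if x ∈ H then (Fintype.card Z : ℝ) else 0) + δ / 2 * Fintype.card Z) := by
    apply Finset.sum_le_sum
    intro x _
    have hle : ((Finset.univ.filter (fun z => R x z)).card : ℝ) ≤ Fintype.card Z := by
      exact_mod_cast Finset.card_le_univ _
    by_cases hx : x ∈ H
    · simp only [hx, if_true]
      have : 0 ≤ δ / 2 * Fintype.card Z := by positivity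
      linarith
    · simp only [hx, if_false]
      rw [hH, Finset.mem_filter] at hx
      push Not at hx
      have := hx (Finset.mem_univ _)
      linarith
  have h2 : ∑ x : X, ((if x ∈ H then (Fintype.card Z : ℝ) else 0) + δ / 2 * Fintype.card Z)
      = H.card * Fintype.card Z + Fintype.card X * (δ / 2 * Fintype.card Z) := by
    rw [Finset.sum_add_distrib]
    simp [Finset.sum_ite_mem]
  have h3 : δ / 2 * Fintype.card X ≤ H.card := by
    have : δ / 2 * Fintype.card X * Fintype.card Z ≤ H.card * Fintype.card Z := by
      nlinarith
    exact le_of_mul_le_mul_right this hz'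
  have h4 : M ≤ H.card := by
    have : (N0 : ℝ) ≤ Fintype.card X := by exact_mod_cast hXN
    have h5 : (M : ℝ) ≤ H.card := by nlinarith
    exact_mod_cast h5
  obtain ⟨S, hSH, hS⟩ := Finset.exists_subset_card_eq h4
  have h6 : M * (δ / 2 * Fintype.card Z) ≤
      ∑ x ∈ S, ((Finset.univ.filter (fun z => R x z)).card : ℝ) := by
    rw [← hS, ← nsmul_eq_mul]
    apply Finset.card_nsmul_le_sum
    intro x hx
    exact (Finset.mem_filter.mp (hSH hx)).2
  have h7 : ∑ x ∈ S, ((Finset.univ.filter (fun z => R x z)).card : ℝ) =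
      ∑ z : Z, ((S.filter (fun x => R x z)).card : ℝ) := by
    simp only [Finset.card_filter]
    push_cast
    rw [Finset.sum_comm]
  set Zg : Finset Z := Finset.univ.filter (fun z => t ≤ (S.filter (fun x => R x z)).card) with hZg
  have h8 : ∑ z : Z, ((S.filter (fun x => R x z)).card : ℝ) ≤
      ∑ z : Z, ((if z ∈ Zg then (M : ℝ) else 0) + t) := by
    apply Finset.sum_le_sum
    intro z _
    have hle : ((S.filter (fun x => R x z)).card : ℝ) ≤ M := by
      rw [← hS]; exact_mod_cast Finset.card_filter_le _ _
    by_cases hx : z ∈ Zg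
    · simp only [hx, if_true]
      have : (0 : ℝ) ≤ t := by positivity
      linarith
    · simp only [hx, if_false]
      rw [hZg, Finset.mem_filter] at hx
      push Not at hx
      have := (hx (Finset.mem_univ _)).le
      have : ((S.filter (fun x => R x z)).card : ℝ) ≤ t := by exact_mod_cast this
      linarith
  have h9 : ∑ z : Z, ((if z ∈ Zg then (M : ℝ) else 0) + t)
      = Zg.card * M + Fintype.card Z * t := by
    rw [Finset.sum_add_distrib]
    simp [Finset.sum_ite_mem]
  have hMpos : (0 : ℝ) < M := by
    by_contra hc
    have : (M : ℝ) ≤ 0 := not_lt.mp hc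
    have : (0:ℝ) ≤ t := by positivity
    nlinarith
  have h10 : δ / 4 * Fintype.card Z ≤ Zg.card := by
    have : δ / 4 * Fintype.card Z * M ≤ Zg.card * M := by
      nlinarith
    exact le_of_mul_le_mul_right this hMpos
  have hch : ∀ z ∈ Zg, ∃ T ∈ S.powerset, T.card = t ∧ ∀ x ∈ T, R x z := by
    intro z hzg
    obtain ⟨T, hT1, hT2⟩ := Finset.exists_subset_card_eq (Finset.mem_filter.mp hzg).2
    refine ⟨T, ?_, hT2, fun x hx => (Finset.mem_filter.mp (hT1 hx)).2⟩
    exact Finset.mem_powerset.mpr (hT1.trans (Finset.filter_subset _ _))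
  choose! f hf1 hf2 hf3 using hch
  obtain ⟨T, hT, hcard⟩ := Finset.exists_le_card_fiber_of_nsmul_le_card_of_maps_to
    (s := Zg) (t := S.powerset) (f := f) (b := δ / 4 / 2 ^ M * Fintype.card Z) hf1
    ⟨∅, by simp⟩ (by
      rw [Finset.card_powerset, hS, nsmul_eq_mul]
      push_cast
      calc (2:ℝ) ^ M * (δ / 4 / 2 ^ M * Fintype.card Z) = δ / 4 * Fintype.card Z := by
            field_simp
        _ ≤ _ := h10)
  have hpos : (0:ℝ) < (Zg.filter (fun z => f z = T)).card :=
    lt_of_lt_of_le (by positivity) hcard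
  obtain ⟨z0, hz0⟩ := Finset.card_pos.mp (by exact_mod_cast hpos)
  rw [Finset.mem_filter] at hz0
  refine ⟨T, hz0.2 ▸ hf2 z0 hz0.1, hcard.trans ?_⟩
  norm_cast
  apply Finset.card_le_card
  intro z hz
  rw [Finset.mem_filter] at hz
  simp only [Finset.mem_filter, Finset.mem_univ, true_and]
  intro x hx
  exact hf3 z hz.1 x (hz.2 ▸ hx)

lemma erdos (k t : ℕ) : ∀ δ : ℝ, 0 < δ → ∃ N0 : ℕ, ∀ (X : Type) [Fintype X]
    (P : (Fin k → X) → Prop), N0 ≤ Fintype.card X →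
      δ * (Fintype.card X : ℝ) ^ k ≤ ((Finset.univ.filter P).card : ℝ) →
      ∃ T : Fin k → Finset X, (∀ i, (T i).card = t) ∧ ∀ s, (∀ i, s i ∈ T i) → P s := by
  induction k with
  | zero =>
    intro δ hδ
    refine ⟨0, fun X _ P _ h => ⟨Fin.elim0, fun i => i.elim0, fun s _ => ?_⟩⟩
    have : (0:ℝ) < (Finset.univ.filter P).card := lt_of_lt_of_le (by simpa using hδ) h
    obtain ⟨s', hs'⟩ := Finset.card_pos.mp (by exact_mod_cast this)
    rw [Subsingleton.elim s s']
    exact (Finset.mem_filter.mp hs').2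
  | succ k ih =>
    intro δ hδ
    obtain ⟨N1, δ', hδ', h1⟩ := erdos_step δ hδ t
    obtain ⟨N2, h2⟩ := ih δ' hδ'
    refine ⟨max N1 N2, fun X _ P hN hP => ?_⟩
    obtain ⟨T0, hT0, hT0'⟩ := h1 X (Fin k → X) (fun x s => P (Fin.cons x s))
      (le_trans (le_max_left _ _) hN) (by
        refine le_trans (le_of_eq ?_) (hP.trans (le_of_eq ?_))
        · rw [Fintype.card_pi]; simp; ring
        · have : (Finset.univ.filter P).card =
            ∑ x : X, (Finset.univ.filter (fun z : Fin k → X => P (Fin.cons x z))).card := by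
            simp only [Finset.card_filter]
            rw [← (Fin.consEquiv (fun _ : Fin (k+1) => X)).sum_comp, Fintype.sum_prod_type]
            rfl
          rw [this]; push_cast; rfl)
    obtain ⟨T, hT, hT'⟩ := h2 X (fun s => ∀ x ∈ T0, P (Fin.cons x s))
      (le_trans (le_max_right _ _) hN) (by
        have : (Fintype.card (Fin k → X) : ℝ) = (Fintype.card X : ℝ) ^ k := by
          rw [Fintype.card_pi]; simp
        rw [← this]; convert hT0')
    refine ⟨Fin.cons T0 T, ?_, ?_⟩
    · intro i
      refine Fin.cases ?_ (fun i => ?_) i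
      · simpa using hT0
      · simpa using hT i
    · intro s hs
      have := hT' (Fin.tail s) (fun i => by simpa [Fin.tail] using hs i.succ) (s 0)
        (by simpa using hs 0)
      simpa using this

/-- iterated density quantifier -/
def Dense {X : Type} (m : ℝ) : (k : ℕ) → ((Fin k → X) → Prop) → Prop
  | 0, P => P Fin.elim0
  | k + 1, P => ∃ A : Finset X, m ≤ A.card ∧ ∀ x ∈ A, Dense m k (fun s => P (Fin.cons x s))

lemma dense_card {X : Type} [Fintype X] (m : ℝ) (hm : 0 ≤ m) (k : ℕ) :
    ∀ (P : (Fin k → X) → Prop), Dense m k P → m ^ k ≤ ((Finset.univ.filter P).card : ℝ) := by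
  induction k with
  | zero =>
    intro P h
    have : (Finset.univ.filter P) = Finset.univ := by
      apply Finset.filter_true_of_mem
      intro s _
      rw [Subsingleton.elim s Fin.elim0]
      exact h
    rw [this]; simp
  | succ k ih =>
    rintro P ⟨A, hA, h⟩
    have : (Finset.univ.filter P).card =
        ∑ x : X, (Finset.univ.filter (fun z : Fin k → X => P (Fin.cons x z))).card := by
      simp only [Finset.card_filter]
      rw [← (Fin.consEquiv (fun _ : Fin (k+1) => X)).sum_comp, Fintype.sum_prod_type]
      rfl
    rw [this]
    push_cast
    calc m ^ (k+1) = m * m ^ k := by ring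
      _ ≤ A.card * m ^ k := by gcongr
      _ ≤ ∑ x ∈ A, ((Finset.univ.filter (fun z : Fin k → X => P (Fin.cons x z))).card : ℝ) := by
          rw [← nsmul_eq_mul]
          exact Finset.card_nsmul_le_sum _ _ _ (fun x hx => ih _ (h x hx))
      _ ≤ _ := Finset.sum_le_sum_of_subset_of_nonneg (Finset.subset_univ _)
          (fun _ _ _ => by positivity)

lemma blowup (k t : ℕ) (δ : ℝ) (hδ : 0 < δ) : ∃ N0 : ℕ, ∀ (X : Type) [Fintype X]
    (P : (Fin k → X) → Prop), N0 ≤ Fintype.card X → Dense (δ * Fintype.card X) k P →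
      ∃ T : Fin k → Fin t → X, (∀ i, Function.Injective (T i)) ∧
        ∀ s : Fin k → Fin t, P (fun i => T i (s i)) := by
  obtain ⟨N0, h⟩ := erdos k t (δ ^ k) (by positivity)
  refine ⟨N0, fun X _ P hN hP => ?_⟩
  obtain ⟨T, hT, hT'⟩ := h X P hN (by
    rw [← mul_pow]; exact dense_card _ (by positivity) _ _ hP)
  refine ⟨fun i j => ((T i).equivFinOfCardEq (hT i)).symm j, fun i => ?_, fun s => ?_⟩
  · exact Subtype.val_injective.comp (Equiv.injective _)
  · exact hT' _ (fun i => Subtype.property _)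

end Posa


namespace Posa

lemma pick {V : Type} (W : Finset V) (a : ℝ) (P Q R : V → Prop)
    (hP : (2 / 3 + a) * W.card ≤ ((W.filter P).card : ℝ))
    (hQ : (2 / 3 + a) * W.card ≤ ((W.filter Q).card : ℝ))
    (hR : (2 / 3 + a) * W.card ≤ ((W.filter R).card : ℝ))
    (E : List V) (hE : (E.length : ℝ) ≤ a * W.card) :
    2 * a * W.card ≤ (((W.filter (fun u => P u ∧ Q u ∧ R u)) \ E.toFinset).card : ℝ) := by
  have h0 : W ⊆ ((W.filter (fun u => P u ∧ Q u ∧ R u)) \ E.toFinset) ∪ E.toFinset ∪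
      (W.filter (fun u => ¬ P u)) ∪ (W.filter (fun u => ¬ Q u)) ∪ (W.filter (fun u => ¬ R u)) := by
    intro u hu
    simp only [Finset.mem_union, Finset.mem_sdiff, Finset.mem_filter]
    tauto
  have h1 := Finset.card_le_card h0
  have h2 : ∀ A B C D E : Finset V, (A ∪ B ∪ C ∪ D ∪ E).card ≤
      A.card + B.card + C.card + D.card + E.card := by
    intro A B C D E
    have := Finset.card_union_le (A ∪ B ∪ C ∪ D) E
    have := Finset.card_union_le (A ∪ B ∪ C) D
    have := Finset.card_union_le (A ∪ B) C
    have := Finset.card_union_le A B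
    omega
  have h3 := h1.trans (h2 _ _ _ _ _)
  have hp := Finset.card_filter_add_card_filter_not (s := W) P
  have hq := Finset.card_filter_add_card_filter_not (s := W) Q
  have hr := Finset.card_filter_add_card_filter_not (s := W) R
  have he := List.toFinset_card_le E
  have h4 : W.card * 1 + (W.filter P).card + (W.filter Q).card + (W.filter R).card ≤
    ((W.filter (fun u => P u ∧ Q u ∧ R u)) \ E.toFinset).card + E.length + 3 * W.card := by omega
  have h5 : (W.card : ℝ) * 1 + (W.filter P).card + (W.filter Q).card + (W.filter R).card ≤
    ((W.filter (fun u => P u ∧ Q u ∧ R u)) \ E.toFinset).card + E.length + 3 * W.card := by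
    exact_mod_cast h4
  linarith

/-- vertex-level validity for a graph relation -/
def KT {V : Type} (K : V → V → Prop) (a b c : V) : Prop := K b c ∧ K a c

lemma connect (a ε : ℝ) (ha : 0 < a) (hε : 0 < ε) : ∃ N0 : ℕ, ∀ (V : Type) [Fintype V]
    (K : V → V → Prop) (_ : ∀ x y, K x y → K y x) (W : Finset V),
    N0 ≤ Fintype.card V → ε * Fintype.card V ≤ W.card →
    (∀ v, (2 / 3 + a) * W.card ≤ ((W.filter (fun u => K v u)).card : ℝ)) →
    ∀ y0 z0 u0 v0, K u0 v0 → ∃ L : List V, L.length = 11 ∧ L.Nodup ∧ (∀ x ∈ L, x ∈ W) ∧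
      Valid (KT K) ([y0, z0] ++ L ++ [u0, v0]) := by
  obtain ⟨N1, h1⟩ := blowup 8 2 (2 * a * ε) (by positivity)
  obtain ⟨N2, h2⟩ := exists_nat_ge (7 / (a * ε))
  rw [div_le_iff₀ (by positivity)] at h2
  refine ⟨max N1 N2, ?_⟩
  intro V _ K hsymm W hN hW hdeg y0 z0 u0 v0 huv
  have h7 : (7 : ℝ) ≤ a * W.card := by
    have : (N2 : ℝ) ≤ Fintype.card V := by exact_mod_cast le_trans (le_max_right _ _) hN
    calc (7:ℝ) ≤ N2 * (a * ε) := h2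
      _ ≤ Fintype.card V * (a * ε) := by gcongr
      _ = a * (ε * Fintype.card V) := by ring
      _ ≤ _ := by gcongr
  have hbd : 2 * a * ε * Fintype.card V ≤ 2 * a * W.card := by
    have : 0 < 2 * a := by positivity
    nlinarith
  have key : ∀ (p q r : V) (E : List V), E.length ≤ 7 → 2 * a * ε * Fintype.card V ≤
      (((W.filter (fun u => K p u ∧ K q u ∧ K r u)) \ E.toFinset).card : ℝ) := by
    intro p q r E hE
    refine hbd.trans (pick W a _ _ _ (hdeg p) (hdeg q) (hdeg r) E ?_)
    have : (E.length : ℝ) ≤ 7 := by exact_mod_cast hE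
    linarith
  have mem : ∀ (p q r : V) (E : List V) (x : V),
      x ∈ ((W.filter (fun u => K p u ∧ K q u ∧ K r u)) \ E.toFinset) →
      x ∈ W ∧ (K p x ∧ K q x ∧ K r x) ∧ x ∉ E := by
    intro p q r E x hx
    simpa [and_assoc] using hx
  -- order of choice: v, u, y, z, w and then the rest
  obtain ⟨T, hTinj, hT⟩ := h1 V (fun s => Function.Injective s ∧ (∀ i, s i ∈ W) ∧
      (K u0 (s 0) ∧ K v0 (s 0)) ∧ (K (s 0) (s 1) ∧ K u0 (s 1)) ∧
      (K y0 (s 2) ∧ K z0 (s 2)) ∧ (K z0 (s 3) ∧ K (s 2) (s 3)) ∧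
      (K (s 2) (s 4) ∧ K (s 1) (s 4)) ∧
      (K (s 2) (s 5) ∧ K (s 3) (s 5) ∧ K (s 4) (s 5)) ∧
      (K (s 2) (s 6) ∧ K (s 4) (s 6) ∧ K (s 1) (s 6)) ∧
      (K (s 1) (s 7) ∧ K (s 4) (s 7) ∧ K (s 0) (s 7)))
    (le_trans (le_max_left _ _) hN) (by
      refine ⟨_, key u0 v0 v0 [] (by simp), fun v hv => ?_⟩
      refine ⟨_, key v u0 u0 [v] (by simp), fun u hu => ?_⟩
      refine ⟨_, key y0 z0 z0 [v, u] (by simp), fun y hy => ?_⟩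
      refine ⟨_, key z0 y y [v, u, y] (by simp), fun z hz => ?_⟩
      refine ⟨_, key y u u [v, u, y, z] (by simp), fun w hw => ?_⟩
      refine ⟨_, key y z w [v, u, y, z, w] (by simp), fun x hx => ?_⟩
      refine ⟨_, key y w u [v, u, y, z, w, x] (by simp), fun x' hx' => ?_⟩
      refine ⟨_, key u w v [v, u, y, z, w, x, x'] (by simp), fun x'' hx'' => ?_⟩
      replace hv := mem _ _ _ _ _ hv
      replace hu := mem _ _ _ _ _ hu
      replace hy := mem _ _ _ _ _ hy
      replace hz := mem _ _ _ _ _ hz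
      replace hw := mem _ _ _ _ _ hw
      replace hx := mem _ _ _ _ _ hx
      replace hx' := mem _ _ _ _ _ hx'
      replace hx'' := mem _ _ _ _ _ hx''
      refine ⟨?_, ?_, ⟨hv.2.1.1, hv.2.1.2.1⟩, ⟨hu.2.1.1, hu.2.1.2.1⟩, ⟨hy.2.1.1, hy.2.1.2.1⟩,
        ⟨hz.2.1.1, hz.2.1.2.1⟩, ⟨hw.2.1.1, hw.2.1.2.1⟩, hx.2.1, hx'.2.1, hx''.2.1⟩
      · rw [← List.nodup_ofFn]
        have : ([x'', x', x, w, z, y, u, v] : List V).Nodup := by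
          have e1 := hu.2.2
          have e2 := hy.2.2
          have e3 := hz.2.2
          have e4 := hw.2.2
          have e5 := hx.2.2
          have e6 := hx'.2.2
          have e7 := hx''.2.2
          simp only [List.mem_cons, List.not_mem_nil, not_or, or_false, not_false_eq_true,
            and_true, List.nodup_cons, List.nodup_nil] at *
          tauto
        exact List.nodup_reverse.mp this
      · intro i
        fin_cases i
        exacts [hv.1, hu.1, hy.1, hz.1, hw.1, hx.1, hx'.1, hx''.1])
  have hF : Function.Injective (fun p : Fin 8 × Fin 2 => T p.1 p.2) := by
    rintro ⟨i, j⟩ ⟨i', j'⟩ h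
    simp only at h
    by_cases hi : i = i'
    · subst hi
      rw [hTinj i h]
    · exfalso
      have := (hT (fun l => if l = i then j else j')).1
      apply hi
      apply this
      simp [Ne.symm hi, h]
  have hall : ∀ p : Fin 8 × Fin 2, T p.1 p.2 ∈ W := fun p => (hT (fun _ => p.2)).2.1 p.1
  refine ⟨List.map (fun p : Fin 8 × Fin 2 => T p.1 p.2)
    [(2,0), (3,0), (5,0), (2,1), (4,0), (6,0), (1,1), (4,1), (7,0), (1,0), (0,0)],
    by simp, List.Nodup.map hF (by decide), ?_, ?_⟩
  · intro x hx
    obtain ⟨p, -, rfl⟩ := List.mem_map.mp hx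
    exact hall p
  · have gg : ∀ (p q r : Fin 2), _ := fun p q r => (hT ![0, p, q, 0, r, 0, 0, 0]).2.2
    have g000 := gg 0 0 0
    have g001 := gg 0 0 1
    have g010 := gg 0 1 0
    have g110 := gg 1 1 0
    have g101 := gg 1 0 1
    simp only [Matrix.cons_val] at g000 g001 g010 g110 g101
    obtain ⟨⟨_, _⟩, ⟨_, _⟩, ⟨_, _⟩, ⟨_, _⟩, ⟨_, _⟩, ⟨_, _, _⟩, ⟨_, _, _⟩, ⟨_, _, _⟩⟩ := g000
    obtain ⟨⟨_, _⟩, ⟨_, _⟩, ⟨_, _⟩, ⟨_, _⟩, ⟨_, _⟩, ⟨_, _, _⟩, ⟨_, _, _⟩, ⟨_, _, _⟩⟩ := g001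
    obtain ⟨⟨_, _⟩, ⟨_, _⟩, ⟨_, _⟩, ⟨_, _⟩, ⟨_, _⟩, ⟨_, _, _⟩, ⟨_, _, _⟩, ⟨_, _, _⟩⟩ := g010
    obtain ⟨⟨_, _⟩, ⟨_, _⟩, ⟨_, _⟩, ⟨_, _⟩, ⟨_, _⟩, ⟨_, _, _⟩, ⟨_, _, _⟩, ⟨_, _, _⟩⟩ := g110
    obtain ⟨⟨_, _⟩, ⟨_, _⟩, ⟨_, _⟩, ⟨_, _⟩, ⟨_, _⟩, ⟨_, _, _⟩, ⟨_, _, _⟩, ⟨_, _, _⟩⟩ := g101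
    simp only [List.map_cons, List.map_nil, List.cons_append, List.nil_append, Valid, KT]
    refine ⟨?_, ?_, ?_, ?_, ?_, ?_, ?_, ?_, ?_, ?_, ?_, ?_, ?_, trivial⟩ <;>
    constructor <;> first | assumption | (apply hsymm; assumption)

/-- abbreviation: all graphs have relative minimum degree `2/3 + a` into `W` -/
def Good {V C : Type} (G : C → SimpleGraph V) (a : ℝ) (W : Finset V) : Prop :=
  ∀ c v, (2 / 3 + a) * W.card ≤ ((W.filter (fun u => (G c).Adj v u)).card : ℝ)

/-- the pair `u v` is an edge in at least `M` graphs with colours from `D` -/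
def Rich {V C : Type} (G : C → SimpleGraph V) (D : Finset C) (M : ℕ) (u v : V) : Prop :=
  M ≤ (D.filter (fun c => (G c).Adj u v)).card

lemma rich_symm {V C : Type} (G : C → SimpleGraph V) (D : Finset C) (M : ℕ) (u v : V)
    (h : Rich G D M u v) : Rich G D M v u := by
  unfold Rich at *
  simpa only [SimpleGraph.adj_comm] using h

lemma rich_ne {V C : Type} (G : C → SimpleGraph V) (D : Finset C) (M : ℕ) (u v : V) (hM : 0 < M)
    (h : Rich G D M u v) : u ≠ v := by
  rintro rfl
  unfold Rich at h
  simp at h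
  omega

lemma rich_deg {V C : Type} (G : C → SimpleGraph V) (a : ℝ) (W : Finset V)
    (hG : Good G a W) (D : Finset C) (M : ℕ) (hD : 0 < D.card) (hM : (M : ℝ) ≤ a / 2 * D.card)
    (v : V) : (2 / 3 + a / 2) * W.card ≤ ((W.filter (fun u => Rich G D M v u)).card : ℝ) := by
  have h1 : (D.card : ℝ) * ((2 / 3 + a) * W.card) ≤
      ∑ c ∈ D, ((W.filter (fun u => (G c).Adj v u)).card : ℝ) := by
    rw [← nsmul_eq_mul]
    exact Finset.card_nsmul_le_sum _ _ _ (fun c _ => hG c v)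
  have h2 : ∑ c ∈ D, ((W.filter (fun u => (G c).Adj v u)).card : ℝ) =
      ∑ u ∈ W, ((D.filter (fun c => (G c).Adj v u)).card : ℝ) := by
    simp only [Finset.card_filter]
    push_cast
    rw [Finset.sum_comm]
  have h3 : ∑ u ∈ W, ((D.filter (fun c => (G c).Adj v u)).card : ℝ) ≤
      ∑ u ∈ W, ((if Rich G D M v u then (D.card : ℝ) else 0) + M) := by
    apply Finset.sum_le_sum
    intro u _
    have hle : ((D.filter (fun c => (G c).Adj v u)).card : ℝ) ≤ D.card := by
      exact_mod_cast Finset.card_filter_le _ _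
    have hM0 : (0:ℝ) ≤ M := by positivity
    by_cases hx : Rich G D M v u
    · simp only [hx, if_true]; linarith
    · simp only [hx, if_false]
      unfold Rich at hx
      have : ((D.filter (fun c => (G c).Adj v u)).card : ℝ) ≤ M := by
        exact_mod_cast (not_le.mp hx).le
      linarith
  have h4 : ∑ u ∈ W, ((if Rich G D M v u then (D.card : ℝ) else 0) + M) =
      (W.filter (fun u => Rich G D M v u)).card * D.card + W.card * M := by
    rw [Finset.sum_add_distrib, ← Finset.sum_filter]
    simp
  have hD' : (0:ℝ) < D.card := by exact_mod_cast hD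
  have h5 : (W.card : ℝ) * M ≤ W.card * (a / 2 * D.card) := by gcongr
  have : (2 / 3 + a / 2) * W.card * D.card ≤
      ((W.filter (fun u => Rich G D M v u)).card : ℝ) * D.card := by nlinarith
  exact le_of_mul_le_mul_right this hD'

/-- deleting few vertices keeps goodness of a degree condition -/
lemma deg_sdiff {V : Type} (P : V → Prop) (W B : Finset V) (a b : ℝ) (ha : 0 < b)
    (hB : (B.card : ℝ) ≤ (a - b) * W.card)
    (h : (2 / 3 + a) * W.card ≤ ((W.filter P).card : ℝ)) :
    (2 / 3 + b) * (W \ B).card ≤ (((W \ B).filter P).card : ℝ) := by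
  have e1 : W.filter P ⊆ (W \ B).filter P ∪ B := by
    intro x hx
    simp only [Finset.mem_union, Finset.mem_filter, Finset.mem_sdiff] at *
    tauto
  have e2 := (Finset.card_le_card e1).trans (Finset.card_union_le _ _)
  have e3 : ((W.filter P).card : ℝ) ≤ ((W \ B).filter P).card + B.card := by exact_mod_cast e2
  have e4 : ((W \ B).card : ℝ) ≤ W.card := by
    exact_mod_cast Finset.card_le_card Finset.sdiff_subset
  nlinarith

end Posa


namespace Posa

lemma level {V : Type} (W : Finset V) (hW : W.Nonempty) (Y : V → ℝ) (p : ℝ) (hp : 0 ≤ p)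
    (hp1 : p ≤ 1) : ∃ w ∈ W, p * W.card ≤ ((W.filter (fun u => Y u ≤ Y w)).card : ℝ) ∧
      (1 - p) * W.card ≤ ((W.filter (fun u => Y w ≤ Y u)).card : ℝ) := by
  set S := W.filter (fun w => p * W.card ≤ ((W.filter (fun u => Y u ≤ Y w)).card : ℝ)) with hS
  have hSne : S.Nonempty := by
    obtain ⟨w, hw, hmax⟩ := Finset.exists_max_image W Y hW
    refine ⟨w, Finset.mem_filter.mpr ⟨hw, ?_⟩⟩
    rw [Finset.filter_true_of_mem (fun u hu => hmax u hu)]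
    have : (0:ℝ) ≤ W.card := by positivity
    nlinarith
  obtain ⟨w, hw, hmin⟩ := Finset.exists_min_image S Y hSne
  have hw' := Finset.mem_filter.mp hw
  refine ⟨w, hw'.1, hw'.2, ?_⟩
  have hL : ((W.filter (fun u => Y u < Y w)).card : ℝ) ≤ p * W.card := by
    rcases (W.filter (fun u => Y u < Y w)).eq_empty_or_nonempty with he | hne
    · rw [he]; simp; positivity
    · obtain ⟨u, hu, hmax⟩ := Finset.exists_max_image _ Y hne
      have hu' := Finset.mem_filter.mp hu
      have hnot : u ∉ S := fun h => absurd (hmin u h) (not_le.mpr hu'.2)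
      have : ¬ (p * W.card ≤ ((W.filter (fun x => Y x ≤ Y u)).card : ℝ)) :=
        fun h => hnot (Finset.mem_filter.mpr ⟨hu'.1, h⟩)
      refine le_trans ?_ (not_le.mp this).le
      norm_cast
      apply Finset.card_le_card
      intro x hx
      exact Finset.mem_filter.mpr ⟨(Finset.mem_filter.mp hx).1, hmax x hx⟩
  have hc := Finset.card_filter_add_card_filter_not (s := W) (fun u => Y u < Y w)
  simp only [not_lt] at hc
  have hc' : ((W.filter (fun u => Y u < Y w)).card : ℝ) +
    ((W.filter (fun u => Y w ≤ Y u)).card : ℝ) = W.card := by exact_mod_cast hc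
  linarith

lemma filter_and_card {V : Type} (W : Finset V) (P Q : V → Prop) :
    ((W.filter P).card : ℝ) + (W.filter Q).card ≤
      (W.filter (fun u => P u ∧ Q u)).card + W.card := by
  have h := Finset.card_union_add_card_inter (W.filter P) (W.filter Q)
  have h2 : W.filter P ∩ W.filter Q = W.filter (fun u => P u ∧ Q u) := by
    ext; simp only [Finset.mem_inter, Finset.mem_filter]; tauto
  rw [h2] at h
  have h3 : (W.filter P ∪ W.filter Q).card ≤ W.card := Finset.card_le_card
    (Finset.union_subset (Finset.filter_subset _ _) (Finset.filter_subset _ _))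
  exact_mod_cast (by omega : (W.filter P).card + (W.filter Q).card ≤
      (W.filter (fun u => P u ∧ Q u)).card + W.card)

lemma block_valid {V : Type} (K : V → V → Prop) {t : ℕ} (T : Fin 3 → Fin t → V)
    (h : ∀ i i' j j', i ≠ i' → K (T i j) (T i' j')) (js : List (Fin t)) :
    Valid (KT K) (js.flatMap (fun j => [T 0 j, T 1 j, T 2 j])) := by
  induction js with
  | nil => simp [Valid]
  | cons j js ih =>
    cases js with
    | nil =>
      simp only [List.flatMap_cons, List.flatMap_nil, List.cons_append, List.nil_append, Valid, KT]
      exact ⟨⟨h _ _ _ _ (by decide), h _ _ _ _ (by decide)⟩, trivial⟩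
    | cons j' js =>
      simp only [List.flatMap_cons, List.cons_append, List.nil_append, Valid, KT] at ih ⊢
      exact ⟨⟨h _ _ _ _ (by decide), h _ _ _ _ (by decide)⟩,
        ⟨h _ _ _ _ (by decide), h _ _ _ _ (by decide)⟩,
        ⟨h _ _ _ _ (by decide), h _ _ _ _ (by decide)⟩, ih⟩

lemma block_sum {V : Type} (Y : V → ℝ) {t : ℕ} (T : Fin 3 → Fin t → V) (τ : ℝ)
    (h : ∀ j, Y (T 0 j) + Y (T 1 j) + Y (T 2 j) ≤ τ) (js : List (Fin t)) :
    ((js.flatMap (fun j => [T 0 j, T 1 j, T 2 j])).map Y).sum ≤ js.length * τ := by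
  induction js with
  | nil => simp
  | cons j js ih =>
    simp only [List.flatMap_cons, List.map_append, List.sum_append, List.length_cons,
      List.map_cons, List.map_nil, List.sum_cons, List.sum_nil]
    push_cast
    have := h j
    linarith

lemma block (a ε ζ : ℝ) (t : ℕ) (ha : 0 < a) (hε : 0 < ε) (hζ : 0 < ζ) (hζ1 : ζ < 1 / 3) :
    ∃ N0 : ℕ, ∀ (V : Type) [Fintype V]
    (K : V → V → Prop) (_ : ∀ x y, K x y → K y x) (_ : ∀ x, ¬ K x x) (W : Finset V),
    N0 ≤ Fintype.card V → 0 < W.card → ε * Fintype.card V ≤ W.card →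
    (∀ v, (2 / 3 + a) * W.card ≤ ((W.filter (fun u => K v u)).card : ℝ)) →
    ∀ (Y : V → ℝ) (Ω : ℝ), (∀ v, 0 ≤ Y v) → (∀ v, Y v ≤ Ω) →
    ∃ (u0 v0 : V) (L : List V), K u0 v0 ∧ (u0 :: v0 :: L).length = 3 * (t + 1) ∧
      (u0 :: v0 :: L).Nodup ∧ (∀ x ∈ u0 :: v0 :: L, x ∈ W) ∧
      Valid (KT K) (u0 :: v0 :: L) ∧
      ((u0 :: v0 :: L).map Y).sum ≤ 3 * (t + 1) * ((∑ v ∈ W, Y v) / W.card + ζ * Ω) := by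
  obtain ⟨N1, h1⟩ := blowup 3 (t + 1) (min ζ a * ε) (by positivity)
  refine ⟨N1, ?_⟩
  intro V _ K hsymm hirr W hN hWpos hW hdeg Y Ω hY0 hYΩ
  have hN' : (0:ℝ) < W.card := by exact_mod_cast hWpos
  have hWne := Finset.card_pos.mp hWpos
  obtain ⟨w1, hw1, l1, g1⟩ := level W hWne Y ζ hζ.le (by linarith)
  obtain ⟨w2, hw2, l2, g2⟩ := level W hWne Y (1/3) (by norm_num) (by norm_num)
  obtain ⟨w3, hw3, l3, g3⟩ := level W hWne Y (2/3) (by norm_num) (by norm_num)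
  have o12 : Y w1 ≤ Y w2 := by
    by_contra hc
    push Not at hc
    have := filter_and_card W (fun u => Y w1 ≤ Y u) (fun u => Y u ≤ Y w2)
    rw [Finset.filter_false_of_mem (s := W) (p := fun u => Y w1 ≤ Y u ∧ Y u ≤ Y w2)] at this
    · simp at this; nlinarith
    · rintro x - ⟨h, h'⟩; linarith
  have o23 : Y w2 ≤ Y w3 := by
    by_contra hc
    push Not at hc
    have := filter_and_card W (fun u => Y w2 ≤ Y u) (fun u => Y u ≤ Y w3)
    rw [Finset.filter_false_of_mem (s := W) (p := fun u => Y w2 ≤ Y u ∧ Y u ≤ Y w3)] at this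
    · simp at this; nlinarith
    · rintro x - ⟨h, h'⟩; linarith
  -- layer cake
  have hsum : W.card * ((1/3 - ζ) * Y w1 + 1/3 * Y w2 + 1/3 * Y w3) ≤ ∑ v ∈ W, Y v := by
    have e1 : ∑ v ∈ W, ((if Y w1 ≤ Y v then Y w1 else 0) +
        (if Y w2 ≤ Y v then (Y w2 - Y w1) else 0) + (if Y w3 ≤ Y v then (Y w3 - Y w2) else 0))
        ≤ ∑ v ∈ W, Y v := by
      apply Finset.sum_le_sum
      intro v _
      have := hY0 v
      split_ifs <;> linarith
    rw [Finset.sum_add_distrib, Finset.sum_add_distrib, ← Finset.sum_filter, ← Finset.sum_filter,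
      ← Finset.sum_filter] at e1
    simp only [Finset.sum_const, nsmul_eq_mul] at e1
    have p1 := mul_le_mul_of_nonneg_right g1 (hY0 w1)
    have p2 := mul_le_mul_of_nonneg_right g2 (sub_nonneg.mpr o12)
    have p3 := mul_le_mul_of_nonneg_right g3 (sub_nonneg.mpr o23)
    nlinarith
  have hτ : Y w1 + Y w2 + Y w3 ≤ 3 * ((∑ v ∈ W, Y v) / W.card + ζ * Ω) := by
    have e1 : (1/3 - ζ) * Y w1 + 1/3 * Y w2 + 1/3 * Y w3 ≤ (∑ v ∈ W, Y v) / W.card := by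
      rw [le_div_iff₀ hN']; linarith
    have := mul_le_mul_of_nonneg_left (hYΩ w1) hζ.le
    linarith
  have hbd : ∀ c : ℝ, min ζ a ≤ c → min ζ a * ε * Fintype.card V ≤ c * W.card := by
    intro c hc
    calc min ζ a * ε * Fintype.card V = min ζ a * (ε * Fintype.card V) := by ring
      _ ≤ min ζ a * W.card := by
        have : 0 < min ζ a := by positivity
        gcongr
      _ ≤ _ := by gcongr
  obtain ⟨T, hTinj, hT⟩ := h1 V (fun s => (∀ i, s i ∈ W) ∧ Y (s 0) ≤ Y w1 ∧ Y (s 1) ≤ Y w2 ∧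
      Y (s 2) ≤ Y w3 ∧ K (s 0) (s 1) ∧ K (s 0) (s 2) ∧ K (s 1) (s 2)) hN (by
    refine ⟨W.filter (fun u => Y u ≤ Y w1), (hbd ζ (min_le_left _ _)).trans l1, fun x hx => ?_⟩
    refine ⟨W.filter (fun u => K x u ∧ Y u ≤ Y w2), (hbd a (min_le_right _ _)).trans ?_,
      fun y hy => ?_⟩
    · have := filter_and_card W (fun u => K x u) (fun u => Y u ≤ Y w2)
      have := hdeg x
      linarith
    refine ⟨W.filter (fun u => K x u ∧ (K y u ∧ Y u ≤ Y w3)),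
      (hbd a (min_le_right _ _)).trans ?_, fun z hz => ?_⟩
    · have := filter_and_card W (fun u => K y u) (fun u => Y u ≤ Y w3)
      have : ((W.filter (fun u => K x u)).card : ℝ) + (W.filter (fun u => K y u ∧ Y u ≤ Y w3)).card
          ≤ (W.filter (fun u => K x u ∧ (K y u ∧ Y u ≤ Y w3))).card + W.card := by
        convert filter_and_card W (fun u => K x u) (fun u => K y u ∧ Y u ≤ Y w3)
      have := hdeg x
      have := hdeg y
      have : 0 ≤ a * W.card := by positivity
      linarith
    rw [Finset.mem_filter] at hx hy hz
    refine ⟨?_, hx.2, hy.2.2, hz.2.2.2, hy.2.1, hz.2.1, hz.2.2.1⟩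
    intro i
    fin_cases i
    exacts [hx.1, hy.1, hz.1])
  have hK : ∀ i i' j j', i ≠ i' → K (T i j) (T i' j') := by
    intro i i' j j' hii
    have hs := hT (fun l => if l = i then j else j')
    obtain ⟨-, -, -, -, k1, k2, k3⟩ := hs
    fin_cases i <;> fin_cases i' <;> simp at hii k1 k2 k3 ⊢ <;>
      first | assumption | (apply hsymm; assumption)
  have hne : ∀ i i' j j', i ≠ i' → T i j ≠ T i' j' := by
    intro i i' j j' hii he
    have := hK i i' j j' hii
    rw [he] at this
    exact hirr _ this
  set js : List (Fin (t+1)) := 0 :: (List.finRange t).map Fin.succ with hjs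
  have hjl : js.length = t + 1 := by simp [hjs]
  have hjn : js.Nodup := by
    rw [hjs, ← List.finRange_succ]; exact List.nodup_finRange _
  set L := ((List.finRange t).map Fin.succ).flatMap (fun j => [T 0 j, T 1 j, T 2 j]) with hL
  have hfull : T 0 0 :: T 1 0 :: (T 2 0 :: L) =
    js.flatMap (fun j => [T 0 j, T 1 j, T 2 j]) := by
    simp [hjs, hL]
  refine ⟨T 0 0, T 1 0, T 2 0 :: L, hK _ _ _ _ (by decide), ?_, ?_, ?_, ?_, ?_⟩
  · rw [hfull]; simp [List.length_flatMap, hjl]; ring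
  · rw [hfull, List.nodup_flatMap]
    constructor
    · intro j _
      simp [hne]
    · refine hjn.imp ?_
      intro i j hij
      simp only [Function.onFun, List.disjoint_cons_left, List.mem_cons, List.not_mem_nil,
        or_false, not_or]
      have inj : ∀ k, T k i ≠ T k j := fun k h => hij (hTinj k h)
      refine ⟨⟨inj 0, hne _ _ _ _ (by decide), hne _ _ _ _ (by decide)⟩,
        ⟨hne _ _ _ _ (by decide), inj 1, hne _ _ _ _ (by decide)⟩,
        ⟨hne _ _ _ _ (by decide), hne _ _ _ _ (by decide), inj 2⟩, ?_⟩
      simp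
  · rw [hfull]
    intro x hx
    obtain ⟨j, -, hj⟩ := List.mem_flatMap.mp hx
    have hall := (hT (fun _ => j)).1
    simp only [List.mem_cons, List.not_mem_nil, or_false] at hj
    rcases hj with rfl | rfl | rfl
    exacts [hall 0, hall 1, hall 2]
  · rw [hfull]; exact block_valid K T hK js
  · rw [hfull]
    refine (block_sum Y T (3 * ((∑ v ∈ W, Y v) / W.card + ζ * Ω)) (fun j => ?_) js).trans
      (le_of_eq ?_)
    · have hs := hT (fun _ => j)
      linarith [hs.2.1, hs.2.2.1, hs.2.2.2.1]
    · rw [hjl]; push_cast; ring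

end Posa


namespace Posa

lemma valid_mono {α : Type} {T T' : α → α → α → Prop} (h : ∀ a b c, T a b c → T' a b c) :
    ∀ l : List α, Valid T l → Valid T' l := by
  intro l hl
  rw [valid_get] at hl ⊢
  exact fun i hi => h _ _ _ (hl i hi)

/-- a vertex with the colours of the edges to its two predecessors -/
abbrev Tok (V C : Type) := V × C × C

/-- validity of a triple of consecutive tokens -/
def TT {V C : Type} (G : C → SimpleGraph V) (ρ σ τ : Tok V C) : Prop :=
  (G τ.2.1).Adj σ.1 τ.1 ∧ (G τ.2.2).Adj ρ.1 τ.1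

/-- vertices of a token list -/
def vs {V C : Type} (l : List (Tok V C)) : List V := l.map (fun τ => τ.1)

/-- colours of a token list -/
def cs {V C : Type} (l : List (Tok V C)) : List C := l.flatMap (fun τ => [τ.2.1, τ.2.2])

@[simp] lemma vs_append {V C : Type} (l m : List (Tok V C)) : vs (l ++ m) = vs l ++ vs m := by
  simp [vs]

@[simp] lemma cs_append {V C : Type} (l m : List (Tok V C)) : cs (l ++ m) = cs l ++ cs m := by
  simp [cs]

@[simp] lemma vs_cons {V C : Type} (τ : Tok V C) (m : List (Tok V C)) :
    vs (τ :: m) = τ.1 :: vs m := by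
  simp [vs]

@[simp] lemma cs_cons {V C : Type} (τ : Tok V C) (m : List (Tok V C)) :
    cs (τ :: m) = τ.2.1 :: τ.2.2 :: cs m := by
  simp [cs]

@[simp] lemma vs_nil {V C : Type} : vs ([] : List (Tok V C)) = [] := rfl
@[simp] lemma cs_nil {V C : Type} : cs ([] : List (Tok V C)) = [] := rfl

lemma vs_length {V C : Type} (l : List (Tok V C)) : (vs l).length = l.length := by simp [vs]
lemma cs_length {V C : Type} (l : List (Tok V C)) : (cs l).length = 2 * l.length := by
  induction l with
  | nil => rfl
  | cons a l ih => simp [ih]; ring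

/-- rainbow square path -/
def RPath {V C : Type} (G : C → SimpleGraph V) (l : List (Tok V C)) : Prop :=
  Valid (TT G) l ∧ (vs l).Nodup ∧ (cs l).Nodup

/-- unused vertices -/
noncomputable def Wl {V C : Type} [Fintype V] (l : List (Tok V C)) : Finset V :=
  Finset.univ.filter (fun v => v ∉ vs l)

/-- unused colours -/
noncomputable def Dl {V C : Type} [Fintype C] (l : List (Tok V C)) : Finset C :=
  Finset.univ.filter (fun v => v ∉ cs l)

lemma unused_card {V : Type} [Fintype V] (l : List V) (h : l.Nodup) :
    (Finset.univ.filter (fun v => v ∉ l)).card + l.length = Fintype.card V := by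
  have h1 := Finset.card_filter_add_card_filter_not (s := (Finset.univ : Finset V)) (fun v => v ∈ l)
  have h2 : (Finset.univ.filter (fun v => v ∈ l)) = l.toFinset := by ext; simp
  rw [h2, List.toFinset_card_of_nodup h, Finset.card_univ] at h1
  omega

lemma Wl_card {V C : Type} [Fintype V] {G : C → SimpleGraph V} {l : List (Tok V C)}
    (h : RPath G l) : (Wl l).card + l.length = Fintype.card V := by
  rw [← vs_length l]; exact unused_card _ h.2.1

lemma Dl_card {V C : Type} [Fintype C] {G : C → SimpleGraph V} {l : List (Tok V C)}
    (h : RPath G l) : (Dl l).card + 2 * l.length = Fintype.card C := by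
  rw [← cs_length l]; exact unused_card _ h.2.2

lemma rich_sdiff {V C : Type} (G : C → SimpleGraph V) (D : Finset C) (M : ℕ) (c d : C) (u v : V)
    (h : Rich G D (M + 2) u v) : Rich G ((D.erase c).erase d) M u v := by
  unfold Rich at *
  have : D.filter (fun c => (G c).Adj u v) ⊆
      insert c (insert d (((D.erase c).erase d).filter (fun c => (G c).Adj u v))) := by
    intro e he
    simp only [Finset.mem_insert, Finset.mem_filter, Finset.mem_erase] at he ⊢
    tauto
  have h1 := Finset.card_le_card this
  have h2 := Finset.card_insert_le c (insert d (((D.erase c).erase d).filter (fun c => (G c).Adj u v)))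
  have h3 := Finset.card_insert_le d ((((D.erase c).erase d).filter (fun c => (G c).Adj u v)))
  omega

lemma colour {V C : Type} (G : C → SimpleGraph V) (us : List V) : ∀ (D : Finset C) (M : ℕ)
    (ρ σ : Tok V C), Valid (KT (Rich G D M)) (ρ.1 :: σ.1 :: us) → 2 * us.length ≤ M →
    ∃ ts : List (Tok V C), vs ts = us ∧ (∀ c ∈ cs ts, c ∈ D) ∧ (cs ts).Nodup ∧
      Valid (TT G) (ρ :: σ :: ts) := by
  induction us with
  | nil => intro D M ρ σ _ _; exact ⟨[], rfl, by simp, by simp, by simp [Valid]⟩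
  | cons u us ih =>
    intro D M ρ σ hv hM
    obtain ⟨M, rfl⟩ : ∃ M', M = M' + 2 := ⟨M - 2, by simp at hM; omega⟩
    obtain ⟨⟨h1, h2⟩, hv⟩ := hv
    have hc1 : 0 < (D.filter (fun c => (G c).Adj σ.1 u)).card := by unfold Rich at h1; omega
    obtain ⟨c1, hc1⟩ := Finset.card_pos.mp hc1
    rw [Finset.mem_filter] at hc1
    have hc2 : 1 < (D.filter (fun c => (G c).Adj ρ.1 u)).card := by unfold Rich at h2; omega
    obtain ⟨c2, hc2, hne⟩ := Finset.exists_mem_ne hc2 c1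
    rw [Finset.mem_filter] at hc2
    have hv' := valid_mono (T' := KT (Rich G ((D.erase c1).erase c2) M)) (fun a b c h =>
      ⟨rich_sdiff _ _ _ _ _ _ _ h.1, rich_sdiff _ _ _ _ _ _ _ h.2⟩) _ hv
    obtain ⟨ts, t1, t2, t3, t4⟩ := ih ((D.erase c1).erase c2) M σ (u, c1, c2) hv'
      (by simp at hM; omega)
    refine ⟨(u, c1, c2) :: ts, by simp [t1], ?_, ?_, ?_⟩
    · intro c hc
      simp only [cs_cons, List.mem_cons] at hc
      rcases hc with rfl | rfl | hc
      · exact hc1.1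
      · exact hc2.1
      · exact Finset.mem_of_mem_erase (Finset.mem_of_mem_erase (t2 c hc))
    · simp only [cs_cons, List.nodup_cons, List.mem_cons, not_or]
      refine ⟨⟨hne.symm, fun h => ?_⟩, fun h => ?_, t3⟩
      · simpa using t2 _ h
      · simpa using t2 _ h
    · exact ⟨⟨hc1.2, hc2.2⟩, t4⟩

lemma rpath_append {V C : Type} [Fintype V] [Fintype C] {G : C → SimpleGraph V}
    {l ts : List (Tok V C)} {ρ σ : Tok V C}
    (hl : RPath G (l ++ [ρ, σ])) (hts : Valid (TT G) (ρ :: σ :: ts)) (h1 : (vs ts).Nodup)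
    (h2 : ∀ v ∈ vs ts, v ∈ Wl (l ++ [ρ, σ])) (h3 : (cs ts).Nodup)
    (h4 : ∀ c ∈ cs ts, c ∈ Dl (l ++ [ρ, σ])) : RPath G (l ++ [ρ, σ] ++ ts) := by
  obtain ⟨a, b, c⟩ := hl
  refine ⟨?_, ?_, ?_⟩
  · have := (valid_append (TT G) l ρ σ ts).mpr ⟨a, hts⟩
    simpa using this
  · rw [vs_append, List.nodup_append']
    refine ⟨b, h1, fun v hv hv' => ?_⟩
    have := h2 v hv'
    simp only [Wl, Finset.mem_filter] at this
    exact this.2 hv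
  · rw [cs_append, List.nodup_append']
    refine ⟨c, h3, fun v hv hv' => ?_⟩
    have := h4 v hv'
    simp only [Dl, Finset.mem_filter] at this
    exact this.2 hv

lemma grow (a ε : ℝ) (ha : 0 < a) (hε : 0 < ε) : ∃ N0 : ℕ, ∀ (V C : Type) [Fintype V] [Fintype C]
    (G : C → SimpleGraph V) (l : List (Tok V C)) (ρ σ : Tok V C), RPath G (l ++ [ρ, σ]) →
    N0 ≤ Fintype.card V →
    ∀ (W' : Finset V) (D' : Finset C) (M : ℕ), W' ⊆ Wl (l ++ [ρ, σ]) → D' ⊆ Dl (l ++ [ρ, σ]) →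
    ε * Fintype.card V ≤ W'.card → 0 < D'.card → (M : ℝ) ≤ a / 2 * D'.card → Good G a W' →
    ∀ (u0 v0 : V) (L : List V), Rich G D' M u0 v0 → (u0 :: v0 :: L).Nodup →
    (∀ x ∈ u0 :: v0 :: L, x ∈ Wl (l ++ [ρ, σ]) ∧ x ∉ W') →
    Valid (KT (Rich G D' M)) (u0 :: v0 :: L) → 2 * (L.length + 13) ≤ M →
    ∃ (ts : List (Tok V C)) (cn : List V), vs ts = cn ++ u0 :: v0 :: L ∧ cn.length = 11 ∧
      (∀ x ∈ cn, x ∈ W') ∧ (∀ c ∈ cs ts, c ∈ D') ∧ RPath G (l ++ [ρ, σ] ++ ts) := by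
  obtain ⟨N0, hN⟩ := connect (a / 2) ε (by linarith) hε
  refine ⟨N0, ?_⟩
  intro V C _ _ G l ρ σ hl hV W' D' M hW hD hεW hD0 hM hG u0 v0 L hK hnd hmem hval hlen
  obtain ⟨cn, c1, c2, c3, c4⟩ := hN V (Rich G D' M) (fun u v => rich_symm _ _ _ _ _) W' hV hεW
    (fun v => rich_deg G a W' hG D' M hD0 hM v) ρ.1 σ.1 u0 v0 hK
  have hv : Valid (KT (Rich G D' M)) (ρ.1 :: σ.1 :: (cn ++ u0 :: v0 :: L)) := by
    have := (valid_append (KT (Rich G D' M)) (ρ.1 :: σ.1 :: cn) u0 v0 L).mpr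
      ⟨by simpa using c4, hval⟩
    simpa using this
  obtain ⟨ts, t1, t2, t3, t4⟩ := colour G _ D' M ρ σ hv (by simp; omega)
  refine ⟨ts, cn, t1, c1, c3, t2, rpath_append hl t4 ?_ ?_ t3 (fun c hc => hD (t2 c hc))⟩
  · rw [t1, List.nodup_append']
    exact ⟨c2, hnd, fun x hx hx' => (hmem x hx').2 (c3 x hx)⟩
  · rw [t1]
    intro v hv
    rcases List.mem_append.mp hv with h | h
    · exact hW (c3 v h)
    · exact (hmem v h).1

end Posa


namespace Posa

/-- the quadruple `a b c d` can absorb the token `ξ` between `b` and `c` -/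
def Absorb {V C : Type} (G : C → SimpleGraph V) (a b c d ξ : Tok V C) : Prop :=
  (G ξ.2.1).Adj b.1 ξ.1 ∧ (G ξ.2.2).Adj a.1 ξ.1 ∧ (G c.2.2).Adj ξ.1 c.1 ∧ (G d.2.2).Adj ξ.1 d.1

/-- a block that is an absorber for `ξ` -/
def IsAbs {V C : Type} (G : C → SimpleGraph V) (ξ : Tok V C) (B : List (Tok V C)) : Prop :=
  ∃ a b c d, B = [a, b, c, d] ∧ Absorb G a b c d ξ

lemma swap_valid {V C : Type} (G : C → SimpleGraph V) (a b c d ξ : Tok V C)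
    (P S : List (Tok V C)) (h : Valid (TT G) (P ++ a :: b :: c :: d :: S))
    (hA : Absorb G a b c d ξ) :
    Valid (TT G) (P ++ a :: b :: ξ :: (c.1, c.2.2, c.2.1) :: d :: S) := by
  rw [valid_append] at h ⊢
  refine ⟨h.1, ?_⟩
  obtain ⟨-, h1, h2, h3⟩ := h
  obtain ⟨k1, k2, k3, k4⟩ := hA
  refine ⟨⟨k1, k2⟩, ⟨k3, h1.1⟩, ⟨h2.1, k4⟩, ?_⟩
  cases S with
  | nil => simp [Valid]
  | cons e S => exact h3

lemma absorb_all {V C : Type} (G : C → SimpleGraph V) (P R : List (Tok V C)) :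
    ∀ (ξs : List (Tok V C)) (B : List (List (Tok V C))),
    Valid (TT G) (P ++ B.flatten ++ R) →
    (∀ ξ ∈ ξs, ξs.length ≤ B.countP (fun b => decide (IsAbs G ξ b))) →
    ∃ l, Valid (TT G) (P ++ l ++ R) ∧ (vs l).Perm (vs B.flatten ++ vs ξs) ∧
      (cs l).Perm (cs B.flatten ++ cs ξs) := by
  intro ξs
  induction ξs with
  | nil => intro B h _; exact ⟨B.flatten, h, by simp, by simp⟩
  | cons ξ ξs ih =>
    intro B h hc
    have h1 : 0 < B.countP (fun b => decide (IsAbs G ξ b)) :=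
      lt_of_lt_of_le (by simp) (hc ξ (by simp))
    obtain ⟨b, hb, hbA⟩ := List.countP_pos_iff.mp h1
    simp only [decide_eq_true_eq] at hbA
    obtain ⟨B1, B2, rfl⟩ := List.append_of_mem hb
    obtain ⟨a, b', c, d, rfl, hA⟩ := hbA
    have hval : Valid (TT G) (P ++ (B1 ++ [a, b', ξ, (c.1, c.2.2, c.2.1), d] :: B2).flatten ++ R) := by
      have := swap_valid G a b' c d ξ (P ++ B1.flatten) (B2.flatten ++ R) (by simpa using h) hA
      simpa using this
    obtain ⟨l, l1, l2, l3⟩ := ih _ hval (by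
      intro ξ' hξ'
      have h2 := hc ξ' (by simp [hξ'])
      simp only [List.length_cons, List.countP_append, List.countP_cons] at h2 ⊢
      split_ifs at h2 <;> omega)
    refine ⟨l, l1, l2.trans ?_, l3.trans ?_⟩
    · rw [List.perm_iff_count]
      intro x
      simp [List.count_append, List.count_cons]
      omega
    · rw [List.perm_iff_count]
      intro x
      simp [List.count_append, List.count_cons]
      omega

lemma full_mem {X : Type} [Fintype X] (l : List X) (h : l.Nodup) (hl : l.length = Fintype.card X)
    (x : X) : x ∈ l := by
  have h1 : l.toFinset = Finset.univ := by
    rw [← Finset.card_eq_iff_eq_univ, List.toFinset_card_of_nodup h, hl]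
  have := Finset.mem_univ x
  rw [← h1] at this
  simpa using this

lemma extract (n : ℕ) (hn : 3 ≤ n) (G : Fin (2 * n) → SimpleGraph (Fin n))
    (τ1 τ2 : Tok (Fin n) (Fin (2 * n))) (l : List (Tok (Fin n) (Fin (2 * n))))
    (hlen : (τ1 :: τ2 :: l).length = n)
    (hv : (vs (τ1 :: τ2 :: l)).Nodup) (hc : (cs (τ1 :: τ2 :: l)).Nodup)
    (hval : Valid (TT G) (τ1 :: τ2 :: l ++ [τ1, τ2])) :
    ∃ (σ : ℕ → Fin n) (φ : ℕ × Bool → Fin (2 * n)),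
          Set.BijOn σ {i | i < n} Set.univ ∧
          Set.BijOn φ {p | p.1 < n} Set.univ ∧
          ∀ i < n,
            (G (φ (i, false))).Adj (σ i) (σ ((i + 1) % n)) ∧
            (G (φ (i, true))).Adj (σ i) (σ ((i + 2) % n)) := by
  set L := τ1 :: τ2 :: l with hL
  have hmod : ∀ i, i % n < L.length := fun i => by rw [hlen]; exact Nat.mod_lt _ (by omega)
  set g : ℕ → Tok (Fin n) (Fin (2 * n)) := fun i => L[i % n]'(hmod i) with hg
  have gmod : ∀ i, g (i % n) = g i := by intro i; simp [hg]
  have gadd : ∀ i, g (i + n) = g i := by intro i; simp [hg]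
  have gget : ∀ j (h : j < (L ++ [τ1, τ2]).length), (L ++ [τ1, τ2])[j] = g j := by
    intro j h
    simp only [List.length_append, hlen, List.length_cons, List.length_nil] at h
    by_cases hj : j < n
    · rw [List.getElem_append_left (by omega)]
      simp [hg, Nat.mod_eq_of_lt hj]
    · rw [List.getElem_append_right (by omega)]
      obtain ⟨k, rfl⟩ : ∃ k, j = k + n := ⟨j - n, by omega⟩
      rw [gadd]
      have : k < 2 := by omega
      simp only [hlen, Nat.add_sub_cancel]
      have hk : k % n = k := Nat.mod_eq_of_lt (by omega)
      interval_cases k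
      · simp [hg, hL]
      · simp only [hg, hk]; simp [hL]
  have hT0 : ∀ i < n, TT G (g i) (g (i + 1)) (g (i + 2)) := by
    intro i hi
    have h := (valid_get _ _).mp hval i (by simp only [List.length_append, hlen, List.length_cons, List.length_nil]; omega)
    rwa [gget, gget, gget] at h
  have hT : ∀ i, TT G (g i) (g (i + 1)) (g (i + 2)) := by
    intro i
    have h := hT0 (i % n) (Nat.mod_lt _ (by omega))
    have e : ∀ k, g (i % n + k) = g (i + k) := by
      intro k; rw [← gmod, Nat.mod_add_mod, gmod]
    rwa [gmod, e, e] at h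
  have hex : ∀ τ ∈ L, ∀ k ≤ 2, ∃ i < n, g (i + k) = τ := by
    intro τ hτ k hk
    obtain ⟨j, hj, rfl⟩ := List.getElem_of_mem hτ
    rw [hlen] at hj
    refine ⟨(j + n - k) % n, Nat.mod_lt _ (by omega), ?_⟩
    rw [← gmod, Nat.mod_add_mod, show j + n - k + k = j + n by omega, gmod, gadd]
    simp [hg, Nat.mod_eq_of_lt hj]
  refine ⟨fun i => (g i).1, fun p => if p.2 then (g (p.1 + 2)).2.2 else (g (p.1 + 1)).2.1, ?_, ?_, ?_⟩
  · have hs : Function.Surjective (fun i : Fin n => (g i).1) := by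
      intro v
      have := full_mem _ hv (by rw [vs_length, hlen]; simp) v
      obtain ⟨τ, hτ, rfl⟩ := List.mem_map.mp this
      obtain ⟨i, hi, h⟩ := hex τ hτ 0 (by omega)
      exact ⟨⟨i, hi⟩, by simp only [add_zero] at h; simp [h]⟩
    have hb := (Fintype.bijective_iff_surjective_and_card _).mpr ⟨hs, rfl⟩
    refine ⟨fun _ _ => trivial, ?_, ?_⟩
    · intro i hi j hj h
      have := @hb.1 ⟨i, hi⟩ ⟨j, hj⟩ h
      simpa using this
    · intro v _
      obtain ⟨i, hi⟩ := hs v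
      exact ⟨i, i.2, hi⟩
  · have hs : Function.Surjective (fun p : Fin n × Bool =>
        if p.2 then (g (p.1 + 2)).2.2 else (g (p.1 + 1)).2.1) := by
      intro c
      have := full_mem _ hc (by rw [cs_length, hlen]; simp) c
      obtain ⟨τ, hτ, h⟩ := List.mem_flatMap.mp this
      simp only [List.mem_cons, List.not_mem_nil, or_false] at h
      rcases h with h | h
      · obtain ⟨i, hi, h'⟩ := hex τ hτ 1 (by omega)
        exact ⟨(⟨i, hi⟩, false), by simp [h', h]⟩
      · obtain ⟨i, hi, h'⟩ := hex τ hτ 2 (by omega)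
        exact ⟨(⟨i, hi⟩, true), by simp [h', h]⟩
    have hb := (Fintype.bijective_iff_surjective_and_card _).mpr ⟨hs, by simp; ring⟩
    refine ⟨fun _ _ => trivial, ?_, ?_⟩
    · rintro ⟨i, x⟩ hi ⟨j, y⟩ hj h
      have := @hb.1 (⟨i, hi⟩, x) (⟨j, hj⟩, y) h
      simpa using this
    · intro v _
      obtain ⟨i, hi⟩ := hs v
      exact ⟨(i.1, i.2), i.1.2, hi⟩
  · intro i hi
    simp only [gmod]
    have h1 := hT i
    have h2 := hT (i + n - 1)
    rw [show i + n - 1 + 1 = i + n by omega, show i + n - 1 + 2 = i + 1 + n by omega, gadd, gadd] at h2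
    exact ⟨h2.1, h1.2⟩

end Posa


namespace Posa

lemma good_sdiff {V C : Type} {G : C → SimpleGraph V} {a b : ℝ} {W B : Finset V} (hb : 0 < b)
    (h : Good G a W) (hB : (B.card : ℝ) ≤ (a - b) * W.card) : Good G b (W \ B) := by
  intro c v
  exact deg_sdiff _ W B a b hb hB (h c v)

lemma pick2 {V : Type} (W : Finset V) (a : ℝ) (ha : 0 < a) (hW : 0 < W.card) (P Q : V → Prop)
    (hP : (2 / 3 + a) * W.card ≤ ((W.filter P).card : ℝ))
    (hQ : (2 / 3 + a) * W.card ≤ ((W.filter Q).card : ℝ)) : ∃ x ∈ W, P x ∧ Q x := by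
  have hW' : (0 : ℝ) < W.card := by exact_mod_cast hW
  have h := pick W a P Q Q hP hQ hQ [] (by simp; positivity)
  have h2 : 0 < ((W.filter (fun u => P u ∧ Q u ∧ Q u)) \ ([] : List V).toFinset).card := by
    have : (0 : ℝ) < 2 * a * W.card := by positivity
    exact_mod_cast lt_of_lt_of_le this h
  obtain ⟨x, hx⟩ := Finset.card_pos.mp h2
  simp only [Finset.mem_sdiff, Finset.mem_filter] at hx
  exact ⟨x, hx.1.1, hx.1.2.1, hx.1.2.2.1⟩

lemma close (a ε : ℝ) (ha : 0 < a) (hε : 0 < ε) : ∃ N0 : ℕ, ∀ (V C : Type) [Fintype V] [Fintype C]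
    (G : C → SimpleGraph V) (m : List (Tok V C)) (τ1 τ2 ρ σ : Tok V C),
    Fintype.card C = 2 * Fintype.card V →
    RPath G (τ1 :: τ2 :: m ++ [ρ, σ]) → (G τ2.2.1).Adj τ1.1 τ2.1 →
    N0 ≤ Fintype.card V →
    ε * Fintype.card V ≤ (Wl (τ1 :: τ2 :: m ++ [ρ, σ])).card →
    Good G a (Wl (τ1 :: τ2 :: m ++ [ρ, σ])) →
    ∃ ts : List (Tok V C), RPath G (τ1 :: τ2 :: m ++ [ρ, σ] ++ ts) ∧
      Valid (TT G) (τ1 :: τ2 :: m ++ [ρ, σ] ++ ts ++ [τ1, τ2]) := by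
  obtain ⟨N0, hN⟩ := grow (a / 2) (ε / 2) (by linarith) (by linarith)
  obtain ⟨N1, hN1⟩ := exists_nat_ge ((52 / a + 4) / ε)
  refine ⟨max N0 N1, ?_⟩
  intro V C _ _ G m τ1 τ2 ρ σ hCV hP h12 hV hWε hG
  set l := τ1 :: τ2 :: m with hl
  set W := Wl (l ++ [ρ, σ]) with hW
  set D := Dl (l ++ [ρ, σ]) with hD
  have hDW : D.card = 2 * W.card := by
    have h1 := Wl_card hP
    have h2 := Dl_card hP
    rw [← hW] at h1
    rw [← hD] at h2
    omega
  have hDW' : (D.card : ℝ) = 2 * W.card := by exact_mod_cast hDW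
  have hV1 : (N1 : ℝ) ≤ Fintype.card V := by exact_mod_cast le_trans (le_max_right _ _) hV
  have hbig : 52 / a + 4 ≤ (W.card : ℝ) := by
    rw [div_le_iff₀ hε] at hN1
    nlinarith
  have h52 : 0 < 52 / a := by positivity
  have hbig2 : 52 ≤ a * W.card := by
    have : 52 / a ≤ (W.card : ℝ) := by linarith
    rw [div_le_iff₀ ha] at this
    linarith
  have hW0 : 0 < W.card := by
    have : (0 : ℝ) < W.card := by linarith
    exact_mod_cast this
  obtain ⟨x, hxW, hx1, hx2⟩ := pick2 W a ha hW0 _ _ (hG τ1.2.1 τ1.1) (hG τ2.2.2 τ2.1)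
  have hM : ((26 : ℕ) : ℝ) ≤ a / 2 * D.card := by push_cast; rw [hDW']; linarith
  have hrd := rich_deg G a W hG D 26 (by omega) hM
  have hG2 : ∀ c v, (2 / 3 + a / 2) * W.card ≤ ((W.filter (fun u => (G c).Adj v u)).card : ℝ) := by
    intro c v
    refine le_trans ?_ (hG c v)
    gcongr; linarith
  obtain ⟨y, hyW, hy1, hy2⟩ := pick2 W (a / 2) (by linarith) hW0 _ _ (hG2 τ1.2.2 τ1.1) (hrd x)
  have hyx : x ≠ y := rich_ne G D 26 x y (by norm_num) hy2
  have hcard2 : ({x, y} : Finset V).card = 2 := Finset.card_pair hyx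
  have hsub : ({x, y} : Finset V) ⊆ W := by
    intro z hz; simp at hz; rcases hz with rfl | rfl <;> assumption
  have hW'c : ((W \ {x, y}).card : ℝ) = W.card - 2 := by
    have := Finset.card_sdiff_add_card_eq_card hsub
    rw [hcard2] at this
    have : ((W \ {x, y}).card : ℝ) + 2 = W.card := by exact_mod_cast this
    linarith
  have hG' : Good G (a / 2) (W \ {x, y}) := good_sdiff (by linarith) hG (by
    rw [hcard2]; push_cast; nlinarith)
  obtain ⟨ts, cn, t1, t2, t3, t4, t5⟩ := hN V C G l ρ σ hP (le_trans (le_max_left _ _) hV)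
    (W \ {x, y}) D 26 Finset.sdiff_subset (subset_refl _) (by rw [hW'c]; linarith) (by omega)
    (by push_cast; rw [hDW']; linarith) hG' y x [] (rich_symm _ _ _ _ _ hy2)
    (by simp [hyx.symm]) (by
      intro z hz
      simp only [List.mem_cons, List.not_mem_nil, or_false] at hz
      rcases hz with rfl | rfl
      · exact ⟨hyW, by simp⟩
      · exact ⟨hxW, by simp⟩) (by simp [Valid]) (by simp)
  refine ⟨ts, t5, ?_⟩
  obtain ⟨ts0, ts1, rfl, -, h1⟩ := List.map_eq_append_iff.mp t1
  obtain ⟨ty, ts2, rfl, hy, h2⟩ := List.map_eq_cons_iff.mp h1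
  obtain ⟨tx, ts3, rfl, hx, h3⟩ := List.map_eq_cons_iff.mp h2
  obtain rfl := List.map_eq_nil_iff.mp h3
  have := (valid_append (TT G) (l ++ [ρ, σ] ++ ts0) ty tx [τ1, τ2]).mpr ⟨by simpa using t5.1, by
    refine ⟨⟨?_, ?_⟩, ⟨?_, ?_⟩, by simp [Valid]⟩
    · rw [hx]; exact hx1.symm
    · rw [hy]; exact hy1.symm
    · exact h12
    · rw [hx]; exact hx2.symm⟩
  simpa using this

end Posa


namespace Posa

lemma avg_pick {V Ξ : Type} [Fintype Ξ] (W : Finset V) (a : ℝ) (ha : 0 < a) (hW : 0 < W.card)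
    (P Q : V → Prop) (R : Ξ → V → Prop) (ω : Ξ → ℝ) (hω : ∀ ξ, 0 ≤ ω ξ)
    (hP : (2 / 3 + a) * W.card ≤ ((W.filter P).card : ℝ))
    (hQ : (2 / 3 + a) * W.card ≤ ((W.filter Q).card : ℝ))
    (hR : ∀ ξ, (2 / 3 + a) * W.card ≤ ((W.filter (R ξ)).card : ℝ))
    (E : List V) (hE : (E.length : ℝ) ≤ a * W.card) :
    ∃ u ∈ W, P u ∧ Q u ∧ u ∉ E ∧ 2 * a * ∑ ξ, ω ξ ≤ ∑ ξ, if R ξ u then ω ξ else 0 := by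
  set S := (W.filter (fun u => P u ∧ Q u)) \ E.toFinset with hS
  have hSW : S ⊆ W := Finset.sdiff_subset.trans (Finset.filter_subset _ _)
  have hWr : (0 : ℝ) < W.card := by exact_mod_cast hW
  have hSne : S.Nonempty := by
    have h := pick W a P Q Q hP hQ hQ E hE
    have h2 : 0 < ((W.filter (fun u => P u ∧ Q u ∧ Q u)) \ E.toFinset).card := by
      have : (0 : ℝ) < 2 * a * W.card := by positivity
      exact_mod_cast lt_of_lt_of_le this h
    obtain ⟨x, hx⟩ := Finset.card_pos.mp h2
    simp only [Finset.mem_sdiff, Finset.mem_filter] at hx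
    exact ⟨x, by simp only [hS, Finset.mem_sdiff, Finset.mem_filter]; tauto⟩
  have hRS : ∀ ξ, 2 * a * W.card ≤ ((S.filter (R ξ)).card : ℝ) := by
    intro ξ
    have h := pick W a P Q (R ξ) hP hQ (hR ξ) E hE
    refine h.trans ?_
    norm_cast
    apply Finset.card_le_card
    intro x hx
    simp only [hS, Finset.mem_sdiff, Finset.mem_filter] at hx ⊢
    tauto
  have hSr : (S.card : ℝ) ≤ W.card := by exact_mod_cast Finset.card_le_card hSW
  have key : ∑ u ∈ S, (2 * a * ∑ ξ, ω ξ) ≤ ∑ u ∈ S, ∑ ξ, (if R ξ u then ω ξ else 0) := by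
    rw [Finset.sum_comm, Finset.sum_const, nsmul_eq_mul]
    have e1 : ∀ ξ, ∑ u ∈ S, (if R ξ u then ω ξ else 0) = (S.filter (R ξ)).card * ω ξ := by
      intro ξ
      rw [← Finset.sum_filter, Finset.sum_const, nsmul_eq_mul]
    simp only [e1]
    rw [Finset.mul_sum, Finset.mul_sum]
    apply Finset.sum_le_sum
    intro ξ _
    rw [← mul_assoc]
    apply mul_le_mul_of_nonneg_right _ (hω ξ)
    have := hRS ξ
    nlinarith
  obtain ⟨u, huS, hu⟩ := Finset.exists_le_of_sum_le hSne key
  have huS' := huS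
  simp only [hS, Finset.mem_sdiff, Finset.mem_filter, List.mem_toFinset] at huS'
  exact ⟨u, hSW huS, huS'.1.2.1, huS'.1.2.2, huS'.2, hu⟩

lemma four {X : Type} (D : Finset X) (h : 4 ≤ D.card) :
    ∃ a b c d, [a, b, c, d].Nodup ∧ ∀ x ∈ [a, b, c, d], x ∈ D := by
  have h1 := Finset.nodup_toList D
  have h2 := Finset.length_toList D
  have h3 : ∀ x ∈ D.toList, x ∈ D := fun x hx => Finset.mem_toList.mp hx
  match hD : D.toList with
  | [] => simp [hD] at h2; omega
  | [_] => simp [hD] at h2; omega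
  | [_, _] => simp [hD] at h2; omega
  | [_, _, _] => simp [hD] at h2; omega
  | a :: b :: c :: d :: r =>
    rw [hD] at h1 h3
    refine ⟨a, b, c, d, ?_, ?_⟩
    · exact (List.nodup_append'.mp (show ([a, b, c, d] ++ r).Nodup by simpa using h1)).1
    · intro x hx
      exact h3 x (by simp at hx ⊢; tauto)

lemma last_two {X : Type} (l : List X) (h : 2 ≤ l.length) : ∃ l0 ρ σ, l = l0 ++ [ρ, σ] := by
  have h1 : l = l.take (l.length - 2) ++ l.drop (l.length - 2) := (List.take_append_drop _ _).symm
  have h2 : (l.drop (l.length - 2)).length = 2 := by simp; omega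
  obtain ⟨a, b, hab⟩ := List.length_eq_two.mp h2
  exact ⟨_, a, b, by rw [← hab]; exact h1⟩

lemma absorber_step (a ε : ℝ) (ha : 0 < a) (hε : 0 < ε) : ∃ N0 : ℕ, ∀ (V C : Type) [Fintype V]
    [Fintype C] (G : C → SimpleGraph V) (l : List (Tok V C)) (ρ σ : Tok V C),
    Fintype.card C = 2 * Fintype.card V → RPath G (l ++ [ρ, σ]) →
    N0 ≤ Fintype.card V → ε * Fintype.card V ≤ (Wl (l ++ [ρ, σ])).card →
    Good G a (Wl (l ++ [ρ, σ])) → ∀ ω : Tok V C → ℝ, (∀ ξ, 0 ≤ ω ξ) →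
    ∃ (cn : List (Tok V C)) (ta tb tc td : Tok V C), cn.length = 11 ∧
      RPath G (l ++ [ρ, σ] ++ (cn ++ [ta, tb, tc, td])) ∧
      a ^ 4 * ∑ ξ, ω ξ ≤ ∑ ξ, if Absorb G ta tb tc td ξ then ω ξ else 0 := by
  obtain ⟨N0, hN⟩ := grow (a / 2) (ε / 2) (by linarith) (by linarith)
  obtain ⟨N1, hN1⟩ := exists_nat_ge ((52 / a + 8) / ε)
  refine ⟨max N0 N1, ?_⟩
  intro V C _ _ G l ρ σ hCV hP hV hWε hG ω hω
  set W := Wl (l ++ [ρ, σ]) with hW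
  set D := Dl (l ++ [ρ, σ]) with hD
  have hDW : D.card = 2 * W.card := by
    have h1 := Wl_card hP
    have h2 := Dl_card hP
    rw [← hW] at h1
    rw [← hD] at h2
    omega
  have hDW' : (D.card : ℝ) = 2 * W.card := by exact_mod_cast hDW
  have hV1 : (N1 : ℝ) ≤ Fintype.card V := by exact_mod_cast le_trans (le_max_right _ _) hV
  have hbig : 52 / a + 8 ≤ (W.card : ℝ) := by
    rw [div_le_iff₀ hε] at hN1
    nlinarith
  have h52 : 0 < 52 / a := by positivity
  have hbig2 : 52 ≤ a * (W.card - 8) := by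
    have : 52 / a ≤ (W.card : ℝ) - 8 := by linarith
    rw [div_le_iff₀ ha] at this
    linarith
  have hbig3 : (8 : ℝ) ≤ W.card := by linarith
  have hW8 : 8 ≤ W.card := by exact_mod_cast hbig3
  have hW0 : 0 < W.card := by omega
  obtain ⟨c1, c2, d1, d2, hcn, hcD⟩ := four D (by omega)
  set D' := D \ [c1, c2, d1, d2].toFinset with hD'
  have hD'c : D.card ≤ D'.card + 4 := by
    have h1 : D.card - [c1, c2, d1, d2].toFinset.card ≤ D'.card := by
      rw [hD']; convert Finset.le_card_sdiff ([c1, c2, d1, d2].toFinset) D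
    have h2 := List.toFinset_card_le [c1, c2, d1, d2]
    simp only [List.length_cons, List.length_nil] at h2
    omega
  have hD'r : (D.card : ℝ) ≤ D'.card + 4 := by exact_mod_cast hD'c
  have hM : ((26 : ℕ) : ℝ) ≤ a / 2 * D'.card := by push_cast; nlinarith
  have hM2 : ((26 : ℕ) : ℝ) ≤ a / 2 / 2 * D'.card := by push_cast; nlinarith
  have hrd := rich_deg G a W hG D' 26 (by omega) hM
  have hG2 : ∀ c v, (2 / 3 + a / 2) * W.card ≤ ((W.filter (fun u => (G c).Adj v u)).card : ℝ) := by
    intro c v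
    refine le_trans ?_ (hG c v)
    gcongr; linarith
  have ha2 : 0 < a / 2 := by linarith
  -- choose the four vertices
  obtain ⟨va, haW, -, -, -, sa⟩ := avg_pick W (a / 2) ha2 hW0 _ _
    (fun (ξ : Tok V C) u => (G ξ.2.2).Adj ξ.1 u) ω hω (hG2 c1 ρ.1) (hG2 c1 ρ.1)
    (fun ξ => hG2 _ _) [] (by simp; positivity)
  set ω1 : Tok V C → ℝ := fun ξ => if (G ξ.2.2).Adj ξ.1 va then ω ξ else 0 with hω1
  have hω1p : ∀ ξ, 0 ≤ ω1 ξ := by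
    intro ξ; simp only [hω1]; split_ifs; exacts [hω ξ, le_refl _]
  obtain ⟨vb, hbW, hab, -, -, sb⟩ := avg_pick W (a / 2) ha2 hW0 _ _
    (fun (ξ : Tok V C) u => (G ξ.2.1).Adj ξ.1 u) ω1 hω1p (hrd va) (hrd va)
    (fun ξ => hG2 _ _) [] (by simp; positivity)
  set ω2 : Tok V C → ℝ := fun ξ => if (G ξ.2.1).Adj ξ.1 vb then ω1 ξ else 0 with hω2
  have hω2p : ∀ ξ, 0 ≤ ω2 ξ := by
    intro ξ; simp only [hω2]; split_ifs; exacts [hω1p ξ, le_refl _]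
  obtain ⟨vc, hcW, hbc, hac, -, sc⟩ := avg_pick W (a / 2) ha2 hW0 _ _
    (fun (ξ : Tok V C) u => (G c2).Adj ξ.1 u) ω2 hω2p (hG2 c1 vb) (hG2 c2 va)
    (fun ξ => hG2 _ _) [] (by simp; positivity)
  set ω3 : Tok V C → ℝ := fun ξ => if (G c2).Adj ξ.1 vc then ω2 ξ else 0 with hω3
  have hω3p : ∀ ξ, 0 ≤ ω3 ξ := by
    intro ξ; simp only [hω3]; split_ifs; exacts [hω2p ξ, le_refl _]
  obtain ⟨vd, hdW, hcd, hbd, had, sd⟩ := avg_pick W (a / 2) ha2 hW0 _ _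
    (fun (ξ : Tok V C) u => (G d2).Adj ξ.1 u) ω3 hω3p (hG2 d1 vc) (hG2 d2 vb)
    (fun ξ => hG2 _ _) [va] (by simp; nlinarith)
  simp only [List.mem_cons, List.not_mem_nil, or_false] at had
  have hab' : va ≠ vb := rich_ne G D' 26 va vb (by norm_num) hab
  have hbc' : vb ≠ vc := hbc.ne
  have hac' : va ≠ vc := hac.ne
  have hcd' : vc ≠ vd := hcd.ne
  have hbd' : vb ≠ vd := hbd.ne
  set B : Finset V := {va, vb, vc, vd} with hB
  have hBc : B.card ≤ 4 := Finset.card_le_four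
  have hBr : (B.card : ℝ) ≤ 4 := by exact_mod_cast hBc
  have hG' : Good G (a / 2) (W \ B) := good_sdiff ha2 hG (by nlinarith)
  have hW'c : (W.card : ℝ) ≤ (W \ B).card + 4 := by
    have := Finset.le_card_sdiff B W
    have h : W.card ≤ (W \ B).card + 4 := by omega
    exact_mod_cast h
  obtain ⟨ts, cn, t1, t2, t3, t4, t5⟩ := hN V C G l ρ σ hP (le_trans (le_max_left _ _) hV)
    (W \ B) D' 26 Finset.sdiff_subset Finset.sdiff_subset (by linarith) (by omega)
    hM2 hG' va vb [] hab
    (by simp [hab']) (by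
      intro z hz
      simp only [List.mem_cons, List.not_mem_nil, or_false] at hz
      rcases hz with rfl | rfl
      · exact ⟨haW, by simp [hB]⟩
      · exact ⟨hbW, by simp [hB]⟩) (by simp [Valid]) (by simp)
  have t1' := t1
  obtain ⟨ts0, ts1, rfl, h0, h1⟩ := List.map_eq_append_iff.mp t1'
  obtain ⟨ta, ts2, rfl, hta, h2⟩ := List.map_eq_cons_iff.mp h1
  obtain ⟨tb, ts3, rfl, htb, h3⟩ := List.map_eq_cons_iff.mp h2
  obtain rfl := List.map_eq_nil_iff.mp h3
  refine ⟨ts0, ta, tb, (vc, c1, c2), (vd, d1, d2), ?_, ?_, ?_⟩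
  · rw [← t2, ← h0]; simp
  · have t5' : RPath G ((l ++ [ρ, σ] ++ ts0) ++ [ta, tb]) := by simpa using t5
    have e : (l ++ [ρ, σ] ++ ts0) ++ [ta, tb] = l ++ [ρ, σ] ++ (ts0 ++ [ta, tb]) := by simp
    have := rpath_append (ts := [(vc, c1, c2), (vd, d1, d2)]) t5' (by
      refine ⟨⟨?_, ?_⟩, ⟨?_, ?_⟩, by simp [Valid]⟩
      · simp only [htb]; exact hbc
      · simp only [hta]; exact hac
      · exact hcd
      · simp only [htb]; exact hbd) (by simp [hcd']) (by
        intro v hv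
        have hv' : v = vc ∨ v = vd := by simpa using hv
        have hvW : v ∈ W ∧ v ∈ B ∧ v ≠ va ∧ v ≠ vb := by
          rcases hv' with rfl | rfl
          · exact ⟨hcW, by simp [hB], hac'.symm, hbc'.symm⟩
          · exact ⟨hdW, by simp [hB], had, hbd'.symm⟩
        obtain ⟨k1, k2, k3, k4⟩ := hvW
        rw [e]
        have k1' := k1
        simp only [hW, Wl, Finset.mem_filter, Finset.mem_univ, true_and] at k1' ⊢
        rw [vs_append, List.mem_append, not_or, t1]
        refine ⟨k1', ?_⟩
        simp only [List.mem_append, List.mem_cons, List.not_mem_nil, or_false, not_or]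
        refine ⟨fun h => ?_, k3, k4⟩
        have := t3 v h
        simp only [Finset.mem_sdiff] at this
        exact this.2 k2) (by simpa using hcn) (by
        intro v hv
        have hv' : v ∈ [c1, c2, d1, d2] := by simpa using hv
        have hvD := hcD v hv'
        rw [e]
        have k1' := hvD
        simp only [hD, Dl, Finset.mem_filter, Finset.mem_univ, true_and] at k1' ⊢
        rw [cs_append, List.mem_append, not_or]
        refine ⟨k1', fun h => ?_⟩
        have := t4 v h
        simp only [hD', Finset.mem_sdiff, List.mem_toFinset] at this
        exact this.2 hv')
    simpa using this
  · have hs : ∑ ξ, (if (G d2).Adj ξ.1 vd then ω3 ξ else 0) ≤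
        ∑ ξ, if Absorb G ta tb (vc, c1, c2) (vd, d1, d2) ξ then ω ξ else 0 := by
      apply Finset.sum_le_sum
      intro ξ _
      simp only [hω3, hω2, hω1, Absorb, hta, htb]
      have := hω ξ
      split_ifs with q1 q2 q3 q4 q5 <;> try first | exact le_refl _ | exact this
      exact absurd (And.intro q3.symm (And.intro q4.symm (And.intro q2 q1))) q5
    have e1 : 2 * (a / 2) = a := by ring
    rw [e1] at sa sb sc sd
    have : a ^ 4 * ∑ ξ, ω ξ = a * (a * (a * (a * ∑ ξ, ω ξ))) := by ring
    rw [this]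
    refine le_trans ?_ hs
    refine le_trans ?_ sd
    gcongr
    refine le_trans ?_ sc
    gcongr
    refine le_trans ?_ sb
    gcongr

end Posa


namespace Posa

lemma poly_exp (c : ℝ) (hc : 0 < c) : ∃ N0 : ℕ, ∀ n : ℕ, N0 ≤ n →
    4 * (n : ℝ) ^ 3 ≤ Real.exp (c * n) := by
  obtain ⟨N0, hN⟩ := exists_nat_ge (96 / c ^ 4)
  refine ⟨N0, fun n hn => ?_⟩
  have hn' : (N0 : ℝ) ≤ n := by exact_mod_cast hn
  have h1 := Real.pow_div_factorial_le_exp (c * n) (by positivity) 4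
  refine le_trans ?_ h1
  have h2 : (Nat.factorial 4 : ℝ) = 24 := by norm_num [Nat.factorial]
  rw [h2, le_div_iff₀ (by norm_num)]
  rw [div_le_iff₀ (by positivity)] at hN
  have h3 : 96 ≤ (n : ℝ) * c ^ 4 := hN.trans (by gcongr)
  calc 4 * (n : ℝ) ^ 3 * 24 = n ^ 3 * 96 := by ring
    _ ≤ n ^ 3 * (n * c ^ 4) := by gcongr
    _ = (c * n) ^ 4 := by ring

lemma Wl_eq {V C : Type} [Fintype V] (l : List (Tok V C)) :
    Wl l = Finset.univ \ (vs l).toFinset := by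
  ext v; simp [Wl]

lemma alpha_le {V C : Type} [Fintype V] (G : C → SimpleGraph V) (α : ℝ) (c : C) (v : V)
    (hG : Good G α Finset.univ) : α ≤ 1 / 3 := by
  have h1 := hG c v
  have h2 : ((Finset.univ.filter (fun u => (G c).Adj v u)).card : ℝ) ≤
      (Finset.univ : Finset V).card := by
    exact_mod_cast Finset.card_filter_le _ _
  have h3 : (0 : ℝ) < (Finset.univ : Finset V).card := by
    exact_mod_cast Finset.card_pos.mpr ⟨v, Finset.mem_univ v⟩
  by_contra h
  push Not at h
  nlinarith

lemma phase1_iter (α : ℝ) (hα : 0 < α) : ∃ N0 : ℕ, ∀ (V C : Type) [Fintype V] [Fintype C]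
    (G : C → SimpleGraph V), Fintype.card C = 2 * Fintype.card V → N0 ≤ Fintype.card V →
    Good G α Finset.univ → ∃ τ1 τ2 : Tok V C, (G τ2.2.1).Adj τ1.1 τ2.1 ∧
    ∀ k : ℕ, (15 * k + 2 : ℝ) ≤ α / 2 * Fintype.card V → ∃ B : List (List (Tok V C)),
      RPath G (τ1 :: τ2 :: B.flatten) ∧ B.flatten.length = 15 * k ∧
      ∑ ξ : Tok V C, ((1 / 2 : ℝ) ^ (B.countP (fun b => decide (IsAbs G ξ b)))) ≤
        (1 - (α / 2) ^ 4 / 2) ^ k * Fintype.card (Tok V C) := by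
  obtain ⟨N0, hN⟩ := absorber_step (α / 2) (1 / 2) (by linarith) (by norm_num)
  refine ⟨max N0 2, ?_⟩
  intro V C _ _ G hCV hV hG
  have hV2 : 2 ≤ Fintype.card V := le_trans (le_max_right _ _) hV
  obtain ⟨c1, c2, c3, c4, hcn, -⟩ := four (Finset.univ : Finset C) (by rw [Finset.card_univ]; omega)
  obtain ⟨v, -⟩ := Finset.card_pos.mp (show 0 < (Finset.univ : Finset V).card by
    rw [Finset.card_univ]; omega)
  have hVr : (2 : ℝ) ≤ (Finset.univ : Finset V).card := by
    rw [Finset.card_univ]; exact_mod_cast hV2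
  have hVr' : (2 : ℝ) ≤ Fintype.card V := by exact_mod_cast hV2
  have hα3 := alpha_le G α c1 v hG
  obtain ⟨u, hu⟩ : ∃ u, (G c3).Adj v u := by
    have h := hG c3 v
    have h2 : (0 : ℝ) < (Finset.univ.filter (fun u => (G c3).Adj v u)).card := by
      refine lt_of_lt_of_le ?_ h; positivity
    obtain ⟨u, hu⟩ := Finset.card_pos.mp (by exact_mod_cast h2)
    exact ⟨u, (Finset.mem_filter.mp hu).2⟩
  refine ⟨(v, c1, c2), (u, c3, c4), hu, ?_⟩
  intro k
  induction k with
  | zero =>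
    intro _
    refine ⟨[], ⟨by simp [Valid], by simp [hu.ne], by simpa using hcn⟩, by simp, ?_⟩
    simp
  | succ k ih =>
    intro hk
    push_cast at hk
    obtain ⟨B, hB1, hB2, hB3⟩ := ih (by linarith)
    obtain ⟨l, ρ, σ, hl⟩ := last_two ((v, c1, c2) :: (u, c3, c4) :: B.flatten) (by simp)
    have hlen : (l ++ [ρ, σ]).length = 15 * k + 2 := by rw [← hl]; simp [hB2]
    rw [hl] at hB1
    have hWc := Wl_card hB1
    have hWc' : ((Wl (l ++ [ρ, σ])).card : ℝ) + (15 * k + 2) = Fintype.card V := by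
      rw [hlen] at hWc; exact_mod_cast hWc
    have hGW : Good G (α / 2) (Wl (l ++ [ρ, σ])) := by
      rw [Wl_eq]
      apply good_sdiff (by linarith) hG
      have h1 : ((vs (l ++ [ρ, σ])).toFinset.card : ℝ) ≤ 15 * k + 2 := by
        have := List.toFinset_card_le (vs (l ++ [ρ, σ]))
        rw [vs_length, hlen] at this
        exact_mod_cast this
      rw [Finset.card_univ]
      linarith
    set ω : Tok V C → ℝ := fun ξ => (1 / 2 : ℝ) ^ (B.countP (fun b => decide (IsAbs G ξ b))) with hω
    obtain ⟨cn, ta, tb, tc, td, h1, h2, h3⟩ := hN V C G l ρ σ hCV hB1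
      (le_trans (le_max_left _ _) hV) (by nlinarith) hGW ω (fun ξ => by positivity)
    refine ⟨B ++ [cn, [ta, tb, tc, td]], ?_, ?_, ?_⟩
    · rw [← hl] at h2
      simpa using h2
    · simp only [List.flatten_append, List.length_append, hB2]
      simp [h1]; ring
    · have hs : ∀ ξ, (1 / 2 : ℝ) ^ ((B ++ [cn, [ta, tb, tc, td]]).countP
          (fun b => decide (IsAbs G ξ b))) ≤ ω ξ - 1 / 2 * (if Absorb G ta tb tc td ξ then ω ξ else 0) := by
        intro ξ
        rw [List.countP_append, pow_add]
        have hp : 0 < ω ξ := by simp only [hω]; positivity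
        by_cases hA : Absorb G ta tb tc td ξ
        · rw [if_pos hA]
          have hI : IsAbs G ξ [ta, tb, tc, td] := ⟨ta, tb, tc, td, rfl, hA⟩
          have h1 : 1 ≤ [cn, [ta, tb, tc, td]].countP (fun b => decide (IsAbs G ξ b)) := by
            simp [List.countP_cons, hI]
          have h2 : (1 / 2 : ℝ) ^ ([cn, [ta, tb, tc, td]].countP (fun b => decide (IsAbs G ξ b)))
              ≤ (1 / 2) ^ 1 := pow_le_pow_of_le_one (by norm_num) (by norm_num) h1
          have := mul_le_mul_of_nonneg_left h2 hp.le
          simp only [hω] at this ⊢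
          linarith
        · rw [if_neg hA]
          have h2 : (1 / 2 : ℝ) ^ ([cn, [ta, tb, tc, td]].countP (fun b => decide (IsAbs G ξ b)))
              ≤ 1 := pow_le_one₀ (by norm_num) (by norm_num)
          have := mul_le_mul_of_nonneg_left h2 hp.le
          simp only [hω] at this ⊢
          linarith
      refine (Finset.sum_le_sum (fun ξ _ => hs ξ)).trans ?_
      rw [Finset.sum_sub_distrib, ← Finset.mul_sum]
      have hκ : (α / 2) ^ 4 ≤ 1 := pow_le_one₀ (by linarith) (by linarith)
      have : (1 - (α / 2) ^ 4 / 2) * ∑ ξ, ω ξ ≤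
          (1 - (α / 2) ^ 4 / 2) * ((1 - (α / 2) ^ 4 / 2) ^ k * Fintype.card (Tok V C)) := by
        apply mul_le_mul_of_nonneg_left hB3; linarith
      rw [pow_succ]
      linarith

lemma phase1 (α : ℝ) (hα : 0 < α) : ∃ ε : ℝ, 0 < ε ∧ ∃ N0 : ℕ, ∀ (V C : Type) [Fintype V]
    [Fintype C] (G : C → SimpleGraph V), Fintype.card C = 2 * Fintype.card V →
    N0 ≤ Fintype.card V → Good G α Finset.univ → ∃ (τ1 τ2 : Tok V C) (B : List (List (Tok V C))),
    (G τ2.2.1).Adj τ1.1 τ2.1 ∧ RPath G (τ1 :: τ2 :: B.flatten) ∧ 2 ≤ B.flatten.length ∧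
    ((τ1 :: τ2 :: B.flatten).length : ℝ) ≤ α / 2 * Fintype.card V ∧
    ∀ ξ : Tok V C, ε * Fintype.card V ≤ B.countP (fun b => decide (IsAbs G ξ b)) := by
  obtain ⟨N0, hN⟩ := phase1_iter α hα
  set γ := α / 60 with hγ
  set κ := (α / 2) ^ 4 with hκ
  have hγ0 : 0 < γ := by positivity
  have hκ0 : 0 < κ := by positivity
  obtain ⟨N1, hN1⟩ := poly_exp (κ * γ / 8) (by positivity)
  obtain ⟨N2, hN2⟩ := exists_nat_ge (2 / γ)
  refine ⟨κ * γ / 8, by positivity, max N0 (max N1 N2), ?_⟩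
  intro V C _ _ G hCV hV hG
  obtain ⟨τ1, τ2, h12, hB⟩ := hN V C G hCV (le_trans (le_max_left _ _) hV) hG
  set n := Fintype.card V with hn
  have hnN1 : N1 ≤ n := le_trans (le_trans (le_max_left _ _) (le_max_right _ _)) hV
  have hnN2 : N2 ≤ n := le_trans (le_trans (le_max_right _ _) (le_max_right _ _)) hV
  have hn2 : 2 ≤ γ * n := by
    rw [div_le_iff₀ hγ0] at hN2
    have : (N2 : ℝ) ≤ n := by exact_mod_cast hnN2
    nlinarith
  set s := ⌊γ * n⌋₊ with hs
  have hs1 : (s : ℝ) ≤ γ * n := Nat.floor_le (by positivity)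
  have hs2 : γ * n < s + 1 := Nat.lt_floor_add_one _
  have hs3 : (15 * s + 2 : ℝ) ≤ α / 2 * n := by
    have : α = 60 * γ := by rw [hγ]; ring
    rw [this]; nlinarith
  obtain ⟨B, hB1, hB2, hB3⟩ := hB s hs3
  refine ⟨τ1, τ2, B, h12, hB1, ?_, ?_, ?_⟩
  · have : (0 : ℝ) < s := by linarith
    have : 0 < s := by exact_mod_cast this
    omega
  · simp only [List.length_cons, hB2]; push_cast; linarith
  · intro ξ
    set m := B.countP (fun b => decide (IsAbs G ξ b)) with hm
    have h1 : (1 / 2 : ℝ) ^ m ≤ (1 - κ / 2) ^ s * Fintype.card (Tok V C) := by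
      refine le_trans ?_ hB3
      exact Finset.single_le_sum (f := fun ξ : Tok V C => (1 / 2 : ℝ) ^ (B.countP (fun b => decide (IsAbs G ξ b))))
        (fun ξ _ => by positivity) (Finset.mem_univ ξ)
    have h2 : (Fintype.card (Tok V C) : ℝ) = 4 * n ^ 3 := by
      rw [Fintype.card_prod, Fintype.card_prod, hCV]; push_cast; ring
    have h3 : Real.exp (-(m : ℝ)) ≤ (1 / 2 : ℝ) ^ m := by
      have e : Real.exp (-(m : ℝ)) = (Real.exp (-1)) ^ m := by
        rw [← Real.exp_nat_mul]; congr 1; ring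
      rw [e]
      apply pow_le_pow_left₀ (Real.exp_pos _).le
      rw [Real.exp_neg]
      have := Real.add_one_le_exp (1 : ℝ)
      rw [one_div]
      exact inv_anti₀ (by norm_num) (by linarith)
    have hκ1 : κ ≤ 1 := by
      have hv : Nonempty V := by
        rw [← Fintype.card_pos_iff]
        by_contra h
        have : (n : ℝ) = 0 := by
          have : n = 0 := by omega
          exact_mod_cast this
        rw [this] at hn2; linarith
      obtain ⟨v⟩ := hv
      have := alpha_le G α ξ.2.1 v hG
      exact pow_le_one₀ (by linarith) (by linarith)
    have h4 : (1 - κ / 2) ^ s ≤ Real.exp (-(κ * s / 2)) := by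
      have e : Real.exp (-(κ * s / 2)) = (Real.exp (-(κ / 2))) ^ s := by
        rw [← Real.exp_nat_mul]; congr 1; ring
      rw [e]
      apply pow_le_pow_left₀ (by linarith)
      have := Real.add_one_le_exp (-(κ / 2))
      linarith
    have h5 := hN1 n hnN1
    have h6 : Real.exp (-(m : ℝ)) ≤ Real.exp (-(κ * s / 2) + κ * γ / 8 * n) := by
      rw [Real.exp_add]
      refine h3.trans (h1.trans ?_)
      rw [h2]
      exact mul_le_mul h4 h5 (by positivity) (Real.exp_pos _).le
    have h7 := Real.exp_le_exp.mp h6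
    have h8 : κ * (γ * n) ≤ κ * (2 * s) := mul_le_mul_of_nonneg_left (by linarith) hκ0.le
    linarith

end Posa


namespace Posa

lemma drift {V I : Type} [Fintype I] (F : I → V → Prop) (W R S : Finset V) (hSR : S ⊆ R)
    (hRW : R ⊆ W) (lam ζ Ω : ℝ) (hlam : 0 ≤ lam) (hN : 0 < (W \ R).card)
    (hl : lam * R.card ≤ (W \ R).card) (ω : I → ℝ) (Y : V → ℝ)
    (hω : ∀ i, ω i = Real.exp (lam * ((W.filter (F i)).card / W.card)))
    (hΩ : Ω = ∑ i, ω i) (hY : ∀ v, Y v = Ω - ∑ i, if F i v then ω i else 0)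
    (hS : ∑ v ∈ S, Y v ≤ S.card * ((∑ v ∈ W, Y v) / W.card + ζ * Ω))
    (hR : R.card ≤ S.card + 11) :
    ∑ i, Real.exp (lam * (((W \ R).filter (F i)).card / (W \ R).card)) ≤
      Ω * (1 + lam * ((11 + S.card * ζ) / (W \ R).card) + (lam * R.card / (W \ R).card) ^ 2) := by
  have hWR : ((W \ R).card : ℝ) = W.card - R.card := by
    have := Finset.card_sdiff_add_card_eq_card hRW
    have : ((W \ R).card : ℝ) + R.card = W.card := by exact_mod_cast this
    linarith
  set N' : ℝ := ((W \ R).card : ℝ) with hN'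
  have hN'0 : 0 < N' := by rw [hN']; exact_mod_cast hN
  set N : ℝ := (W.card : ℝ) with hNdef
  set r : ℝ := (R.card : ℝ) with hr
  have hr0 : 0 ≤ r := by positivity
  have hNp : 0 < N := by linarith
  have hrSr : r ≤ S.card + 11 := by rw [hr]; exact_mod_cast hR
  have hω0 : ∀ i, 0 < ω i := fun i => by rw [hω]; exact Real.exp_pos _
  have hΩ0 : 0 ≤ Ω := by rw [hΩ]; exact Finset.sum_nonneg (fun i _ => (hω0 i).le)
  set f : I → ℝ := fun i => ((W.filter (F i)).card : ℝ) with hf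
  set q : I → ℝ := fun i => ((R.filter (F i)).card : ℝ) with hq
  have hf' : ∀ i, (((W \ R).filter (F i)).card : ℝ) = f i - q i := by
    intro i
    have h1 : (W \ R).filter (F i) = W.filter (F i) \ R.filter (F i) := by
      ext v; simp only [Finset.mem_filter, Finset.mem_sdiff]; tauto
    have h2 := Finset.card_sdiff_add_card_eq_card (Finset.filter_subset_filter (F i) hRW)
    rw [h1]
    have : ((W.filter (F i) \ R.filter (F i)).card : ℝ) + q i = f i := by
      simp only [hq, hf]; exact_mod_cast h2
    linarith
  have hfN : ∀ i, f i ≤ N := fun i => by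
    simp only [hf, hNdef]; exact_mod_cast Finset.card_filter_le _ _
  have hf0 : ∀ i, 0 ≤ f i := fun i => by simp only [hf]; positivity
  have hqr : ∀ i, q i ≤ r := fun i => by
    simp only [hq, hr]; exact_mod_cast Finset.card_filter_le _ _
  have hq0 : ∀ i, 0 ≤ q i := fun i => by simp only [hq]; positivity
  set d : I → ℝ := fun i => (r * f i / N - q i) / N' with hd
  have hdec : ∀ i, lam * ((f i - q i) / N') = lam * (f i / N) + lam * d i := by
    intro i
    simp only [hd]
    rw [← mul_add]
    congr 1
    have : r = N - N' := by linarith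
    rw [this]
    field_simp
    ring
  have hrf : ∀ i, r * f i / N ≤ r := fun i => by
    rw [div_le_iff₀ hNp]; exact mul_le_mul_of_nonneg_left (hfN i) hr0
  have hrf0 : ∀ i, 0 ≤ r * f i / N := fun i => div_nonneg (mul_nonneg hr0 (hf0 i)) hNp.le
  have hdabs : ∀ i, |lam * d i| ≤ lam * r / N' := by
    intro i
    rw [abs_mul, abs_of_nonneg hlam, mul_div_assoc]
    apply mul_le_mul_of_nonneg_left _ hlam
    simp only [hd]
    rw [abs_div, abs_of_pos hN'0]
    gcongr
    rw [abs_le]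
    constructor
    · linarith [hqr i, hrf0 i]
    · linarith [hq0 i, hrf i]
  have hl1 : lam * r / N' ≤ 1 := by rw [div_le_one hN'0]; exact hl
  have hterm : ∀ i, Real.exp (lam * (((W \ R).filter (F i)).card / N')) ≤
      ω i * (1 + (lam * r / N') ^ 2) + lam * (ω i * d i) := by
    intro i
    rw [hf' i, hdec i, Real.exp_add]
    have e1 : Real.exp (lam * (f i / N)) = ω i := (hω i).symm
    rw [e1]
    have h1 := Real.abs_exp_sub_one_sub_id_le ((hdabs i).trans hl1)
    have h2 := (abs_le.mp h1).2
    have h3 : (lam * d i) ^ 2 ≤ (lam * r / N') ^ 2 := by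
      rw [← sq_abs (lam * d i)]
      exact pow_le_pow_left₀ (abs_nonneg _) (hdabs i) 2
    have h4 : Real.exp (lam * d i) ≤ 1 + (lam * r / N') ^ 2 + lam * d i := by linarith
    have := mul_le_mul_of_nonneg_left h4 (hω0 i).le
    linarith
  refine (Finset.sum_le_sum (fun i _ => hterm i)).trans ?_
  rw [Finset.sum_add_distrib, ← Finset.sum_mul, ← hΩ, ← Finset.mul_sum]
  have hsw : ∀ A : Finset V, ∑ v ∈ A, Y v = A.card * Ω - ∑ i, ω i * (A.filter (F i)).card := by
    intro A
    simp only [hY]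
    rw [Finset.sum_sub_distrib, Finset.sum_const, nsmul_eq_mul, Finset.sum_comm]
    congr 1
    apply Finset.sum_congr rfl
    intro i _
    rw [← Finset.sum_filter, Finset.sum_const, nsmul_eq_mul, mul_comm]
  rw [hsw, hsw] at hS
  have hS' : ∑ i, ω i * ((S.filter (F i)).card : ℝ) ≤ ∑ i, ω i * q i := by
    apply Finset.sum_le_sum
    intro i _
    apply mul_le_mul_of_nonneg_left _ (hω0 i).le
    simp only [hq]
    exact_mod_cast Finset.card_le_card (Finset.filter_subset_filter _ hSR)
  set X : ℝ := ∑ i, ω i * ((W.filter (F i)).card : ℝ) with hX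
  have hXf : X = ∑ i, ω i * f i := rfl
  have hXN : X ≤ N * Ω := by
    rw [hX, hΩ, Finset.mul_sum]
    apply Finset.sum_le_sum
    intro i _
    rw [mul_comm]
    exact mul_le_mul_of_nonneg_right (hfN i) (hω0 i).le
  have hX0 : 0 ≤ X := Finset.sum_nonneg (fun i _ => mul_nonneg (hω0 i).le (hf0 i))
  have hdsum : ∑ i, ω i * d i = (r * (X / N) - ∑ i, ω i * q i) / N' := by
    rw [hXf, Finset.sum_div, Finset.mul_sum, ← Finset.sum_sub_distrib, Finset.sum_div]
    apply Finset.sum_congr rfl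
    intro i _
    simp only [hd]
    ring
  have hXd : X / N ≤ Ω := by rw [div_le_iff₀ hNp]; linarith
  have hXd0 : 0 ≤ X / N := by positivity
  have e2 : (N * Ω - X) / N = Ω - X / N := by field_simp
  rw [← hNdef, e2] at hS
  have hbr : r * (X / N) - ∑ i, ω i * q i ≤ Ω * (11 + S.card * ζ) := by
    have h1 : r * (X / N) ≤ (S.card + 11) * (X / N) := by gcongr
    nlinarith
  have hfin : ∑ i, ω i * d i ≤ Ω * (11 + S.card * ζ) / N' := by
    rw [hdsum]; gcongr
  have := mul_le_mul_of_nonneg_left hfin hlam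
  calc _ ≤ Ω * (1 + (lam * r / N') ^ 2) + lam * (Ω * (11 + S.card * ζ) / N') := by gcongr
    _ = _ := by ring

end Posa


namespace Posa

/-- exponential potential controlling all relative degrees into `W` -/
noncomputable def Phi {V C : Type} [Fintype V] [Fintype C] (G : C → SimpleGraph V) (lam : ℝ)
    (W : Finset V) : ℝ :=
  ∑ i : V × C, Real.exp (lam * ((W.filter (fun u => ¬ (G i.2).Adj i.1 u)).card / W.card))

lemma Wl_append {V C : Type} [Fintype V] (l m : List (Tok V C)) :
    Wl (l ++ m) = Wl l \ (vs m).toFinset := by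
  ext v; simp [Wl]

lemma cover_step (a ε ζ : ℝ) (t : ℕ) (ha : 0 < a) (hε : 0 < ε) (hζ : 0 < ζ) (hζ1 : ζ < 1 / 3) :
    ∃ N0 : ℕ, ∀ (V C : Type) [Fintype V] [Fintype C] (G : C → SimpleGraph V)
    (l : List (Tok V C)) (ρ σ : Tok V C),
    Fintype.card C = 2 * Fintype.card V → RPath G (l ++ [ρ, σ]) →
    N0 ≤ Fintype.card V → ε * Fintype.card V ≤ (Wl (l ++ [ρ, σ])).card →
    Good G a (Wl (l ++ [ρ, σ])) → ∀ lam : ℝ, 0 ≤ lam →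
    lam * ((3 * t + 14 : ℕ) : ℝ) + ((3 * t + 14 : ℕ) : ℝ) ≤ (Wl (l ++ [ρ, σ])).card →
    ∃ ts : List (Tok V C), ts.length = 3 * t + 14 ∧ RPath G (l ++ [ρ, σ] ++ ts) ∧
      Phi G lam (Wl (l ++ [ρ, σ] ++ ts)) ≤ Phi G lam (Wl (l ++ [ρ, σ])) *
        (1 + lam * ((11 + ((3 * t + 14 : ℕ) : ℝ) * ζ) / (Wl (l ++ [ρ, σ] ++ ts)).card) +
          (lam * ((3 * t + 14 : ℕ) : ℝ) / (Wl (l ++ [ρ, σ] ++ ts)).card) ^ 2) := by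
  obtain ⟨N0, hN⟩ := grow (a / 2) (ε / 2) (by linarith) (by linarith)
  obtain ⟨N2, hN2⟩ := block (a / 2) ε ζ t (by linarith) hε hζ hζ1
  set r : ℕ := 3 * t + 14 with hr
  obtain ⟨N1, hN1⟩ := exists_nat_ge ((4 * r / a + 2 * r) / ε)
  refine ⟨max N0 (max N1 N2), ?_⟩
  intro V C _ _ G l ρ σ hCV hP hV hWε hG lam hlam hlamr
  set W := Wl (l ++ [ρ, σ]) with hW
  set D := Dl (l ++ [ρ, σ]) with hD
  have hDW : D.card = 2 * W.card := by
    have h1 := Wl_card hP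
    have h2 := Dl_card hP
    rw [← hW] at h1
    rw [← hD] at h2
    omega
  have hDW' : (D.card : ℝ) = 2 * W.card := by exact_mod_cast hDW
  have hV1 : (N1 : ℝ) ≤ Fintype.card V := by
    exact_mod_cast le_trans (le_trans (le_max_left _ _) (le_max_right _ _)) hV
  have hr14 : (14 : ℝ) ≤ r := by rw [hr]; push_cast; linarith [(Nat.cast_nonneg t : (0:ℝ) ≤ t)]
  have hbig : 4 * r / a + 2 * r ≤ (W.card : ℝ) := by
    rw [div_le_iff₀ hε] at hN1
    nlinarith
  have h52 : 0 < 4 * r / a := by positivity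
  have hbig2 : 4 * r ≤ a * W.card := by
    have : 4 * r / a ≤ (W.card : ℝ) := by linarith
    rw [div_le_iff₀ ha] at this
    linarith
  have hbig3 : 2 * (r : ℝ) ≤ W.card := by linarith
  have hW8 : 2 * r ≤ W.card := by exact_mod_cast hbig3
  have hW0 : 0 < W.card := by omega
  have hM : ((2 * r : ℕ) : ℝ) ≤ a / 2 * D.card := by push_cast; rw [hDW']; nlinarith
  have hM2 : ((2 * r : ℕ) : ℝ) ≤ a / 2 / 2 * D.card := by push_cast; rw [hDW']; nlinarith
  have hrd := rich_deg G a W hG D (2 * r) (by omega) hM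
  set F : V × C → V → Prop := fun i u => ¬ (G i.2).Adj i.1 u with hF
  set ω : V × C → ℝ := fun i => Real.exp (lam * ((W.filter (F i)).card / W.card)) with hω
  set Ω : ℝ := ∑ i, ω i with hΩ
  have hω0 : ∀ i, 0 ≤ ω i := fun i => (Real.exp_pos _).le
  set Y : V → ℝ := fun v => Ω - ∑ i, if F i v then ω i else 0 with hY
  obtain ⟨u0, v0, L, b1, b2, b3, b4, b5, b6⟩ := hN2 V (Rich G D (2 * r))
    (fun u v => rich_symm _ _ _ _ _) (fun x h => rich_ne G D (2 * r) x x (by omega) h rfl) W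
    (le_trans (le_trans (le_max_right _ _) (le_max_right _ _)) hV) hW0 hWε hrd Y Ω
    (by
      intro v
      simp only [hY, sub_nonneg, hΩ]
      apply Finset.sum_le_sum
      intro i _
      split_ifs
      exacts [le_refl _, hω0 i])
    (by
      intro v
      simp only [hY, sub_le_self_iff]
      apply Finset.sum_nonneg
      intro i _
      split_ifs
      exacts [hω0 i, le_refl _])
  set S : Finset V := (u0 :: v0 :: L).toFinset with hS
  have hSc : S.card = 3 * (t + 1) := by rw [hS, List.toFinset_card_of_nodup b3, b2]
  have hSr : (S.card : ℝ) ≤ r := by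
    have : S.card ≤ r := by omega
    exact_mod_cast this
  have hG' : Good G (a / 2) (W \ S) := good_sdiff (by linarith) hG (by nlinarith)
  have hW'c : (W.card : ℝ) ≤ (W \ S).card + r := by
    have := Finset.le_card_sdiff S W
    have h : W.card ≤ (W \ S).card + r := by omega
    exact_mod_cast h
  obtain ⟨ts, cn, t1, t2, t3, t4, t5⟩ := hN V C G l ρ σ hP (le_trans (le_max_left _ _) hV)
    (W \ S) D (2 * r) Finset.sdiff_subset (subset_refl _) (by linarith) (by omega)
    hM2 hG' u0 v0 L b1 b3 (by
      intro z hz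
      refine ⟨b4 z hz, ?_⟩
      simp only [Finset.mem_sdiff, not_and, not_not]
      intro _
      rw [hS]; exact List.mem_toFinset.mpr hz) b5 (by simp at b2; omega)
  have hlen : ts.length = r := by
    rw [← vs_length ts, t1, List.length_append, b2, t2]; omega
  refine ⟨ts, hlen, t5, ?_⟩
  set R : Finset V := (vs ts).toFinset with hR
  have hRc : R.card = r := by
    have h1 : (vs ts).Nodup := by
      have := t5.2.1
      rw [vs_append, List.nodup_append'] at this
      exact this.2.1
    rw [hR, List.toFinset_card_of_nodup h1, vs_length, hlen]
  have hWR : Wl (l ++ [ρ, σ] ++ ts) = W \ R := Wl_append _ _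
  rw [hWR]
  have hRW : R ⊆ W := by
    intro x hx
    rw [hR, List.mem_toFinset, t1, List.mem_append] at hx
    rcases hx with h | h
    · exact Finset.sdiff_subset (t3 x h)
    · exact b4 x h
  have hSR : S ⊆ R := by
    intro x hx
    rw [hS, List.mem_toFinset] at hx
    rw [hR, List.mem_toFinset, t1, List.mem_append]
    exact Or.inr hx
  have hWRc := Finset.card_sdiff_add_card_eq_card hRW
  have hWRc' : ((W \ R).card : ℝ) + r = W.card := by rw [hRc] at hWRc; exact_mod_cast hWRc
  have hb : ∑ v ∈ S, Y v ≤ S.card * ((∑ v ∈ W, Y v) / W.card + ζ * Ω) := by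
    rw [hS, List.sum_toFinset _ b3, ← hS, hSc]
    refine b6.trans (le_of_eq ?_)
    push_cast; ring
  have hd := drift F W R S hSR hRW lam ζ Ω hlam (by omega) (by rw [hRc]; linarith) ω Y
    (fun i => by simp only [hω]; congr!) rfl (fun v => by simp only [hY]; congr!) hb (by omega)
  have hΩ0 : 0 ≤ Ω := Finset.sum_nonneg (fun i _ => hω0 i)
  refine le_trans (le_of_eq ?_) (hd.trans ?_)
  · unfold Phi; congr!
  rw [hRc]
  have hPhi : Phi G lam W = Ω := by
    simp only [Phi, hΩ, hω]; congr!
  rw [hPhi]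
  gcongr

end Posa


namespace Posa

lemma good_of_phi {V C : Type} [Fintype V] [Fintype C] (G : C → SimpleGraph V) (lam b : ℝ)
    (W : Finset V) (hlam : 0 < lam) (hW : 0 < W.card)
    (h : Phi G lam W ≤ Real.exp (lam * (1 / 3 - b))) : Good G b W := by
  intro c v
  have h1 : Real.exp (lam * ((W.filter (fun u => ¬ (G c).Adj v u)).card / W.card)) ≤ Phi G lam W := by
    have h0 := Finset.single_le_sum (s := Finset.univ)
      (f := fun i : V × C => Real.exp (lam * ((W.filter (fun u => ¬ (G i.2).Adj i.1 u)).card / W.card)))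
      (fun i _ => (Real.exp_pos _).le) (Finset.mem_univ (v, c))
    unfold Phi
    exact h0
  have h2 := Real.exp_le_exp.mp (h1.trans h)
  have h3 := le_of_mul_le_mul_left h2 hlam
  have hWr : (0 : ℝ) < W.card := by exact_mod_cast hW
  rw [div_le_iff₀ hWr] at h3
  have h4 := Finset.card_filter_add_card_filter_not (s := W) (fun u => (G c).Adj v u)
  have h5 : ((W.filter (fun u => (G c).Adj v u)).card : ℝ) +
      (W.filter (fun u => ¬ (G c).Adj v u)).card = W.card := by exact_mod_cast h4
  linarith

lemma phi_of_good {V C : Type} [Fintype V] [Fintype C] (G : C → SimpleGraph V) (lam b : ℝ)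
    (W : Finset V) (hlam : 0 < lam) (hW : 0 < W.card) (h : Good G b W) :
    Phi G lam W ≤ Fintype.card (V × C) * Real.exp (lam * (1 / 3 - b)) := by
  unfold Phi
  have : (Fintype.card (V × C) : ℝ) * Real.exp (lam * (1 / 3 - b)) =
      ∑ _i : V × C, Real.exp (lam * (1 / 3 - b)) := by
    rw [Finset.sum_const, nsmul_eq_mul, Finset.card_univ]
  rw [this]
  apply Finset.sum_le_sum
  rintro ⟨v, c⟩ _
  apply Real.exp_le_exp.mpr
  apply mul_le_mul_of_nonneg_left _ hlam.le
  have hWr : (0 : ℝ) < W.card := by exact_mod_cast hW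
  rw [div_le_iff₀ hWr]
  have h3 := h c v
  have h4 := Finset.card_filter_add_card_filter_not (s := W) (fun u => (G c).Adj v u)
  have h5 : ((W.filter (fun u => (G c).Adj v u)).card : ℝ) +
      (W.filter (fun u => ¬ (G c).Adj v u)).card = W.card := by exact_mod_cast h4
  simp only
  linarith

set_option maxHeartbeats 1000000 in
lemma phase2 (α ε : ℝ) (hα : 0 < α) (hε : 0 < ε) (hε1 : ε ≤ 1 / 2) : ∃ N0 : ℕ,
    ∀ (V C : Type) [Fintype V]
    [Fintype C] (G : C → SimpleGraph V) (l0 : List (Tok V C)),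
    Fintype.card C = 2 * Fintype.card V →
    N0 ≤ Fintype.card V → Good G α Finset.univ → RPath G l0 → 2 ≤ l0.length →
    (l0.length : ℝ) ≤ α / 2 * Fintype.card V →
    ∃ m : List (Tok V C), RPath G (l0 ++ m) ∧ Good G (α / 4) (Wl (l0 ++ m)) ∧
      ε / 2 * Fintype.card V ≤ (Wl (l0 ++ m)).card ∧
      ((Wl (l0 ++ m)).card : ℝ) ≤ ε * Fintype.card V := by
  obtain ⟨t, ht⟩ := exists_nat_ge (704 / (α * ε))
  set ζ := min (α * ε / 64) (1 / 4) with hζ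
  have hζ0 : 0 < ζ := by rw [hζ]; positivity
  have hζ1 : ζ < 1 / 3 := lt_of_le_of_lt (min_le_right _ _) (by norm_num)
  have hζ2 : ζ ≤ α * ε / 64 := min_le_left _ _
  obtain ⟨N0, hN0⟩ := cover_step (α / 4) (ε / 2) ζ t (by linarith) (by linarith) hζ0 hζ1
  set r : ℕ := 3 * t + 14 with hr
  have hrt : (t : ℝ) ≤ r := by rw [hr]; push_cast; linarith [(Nat.cast_nonneg t : (0:ℝ) ≤ t)]
  have hr14 : (14 : ℝ) ≤ r := by rw [hr]; push_cast; linarith [(Nat.cast_nonneg t : (0:ℝ) ≤ t)]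
  have hr0 : (0 : ℝ) < r := by linarith
  set κ : ℝ := min (ε / (2 * r)) (α * ε ^ 2 / (128 * r)) with hκ
  have hκ0 : 0 < κ := by rw [hκ]; positivity
  have hκ1 : κ * r ≤ ε / 2 := by
    have : κ ≤ ε / (2 * r) := min_le_left _ _
    rw [le_div_iff₀ (by positivity)] at this
    linarith
  have hκ2 : 128 * (κ * r) ≤ α * ε ^ 2 := by
    have : κ ≤ α * ε ^ 2 / (128 * r) := min_le_right _ _
    rw [le_div_iff₀ (by positivity)] at this
    linarith
  obtain ⟨N1, hN1⟩ := poly_exp (κ * α / 8) (by positivity)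
  obtain ⟨N2, hN2⟩ := exists_nat_ge (2 * r / ε)
  refine ⟨max N0 (max N1 (max N2 1)), ?_⟩
  intro V C _ _ G l0 hCV hV hG hP hl2 hlα
  simp only [max_le_iff] at hV
  obtain ⟨hV0, hV1, hV2, hV3⟩ := hV
  have hαle : α ≤ 1 / 3 := by
    obtain ⟨v⟩ := Fintype.card_pos_iff.mp (show 0 < Fintype.card V by omega)
    obtain ⟨c⟩ := Fintype.card_pos_iff.mp (show 0 < Fintype.card C by omega)
    exact alpha_le G α c v hG
  set n : ℝ := (Fintype.card V : ℝ) with hn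
  have hn1 : 1 ≤ n := by rw [hn]; exact_mod_cast hV3
  have hn0 : 0 < n := by linarith
  have hrn : r ≤ ε / 2 * n := by
    rw [div_le_iff₀ hε] at hN2
    have : (N2 : ℝ) ≤ n := by rw [hn]; exact_mod_cast hV2
    nlinarith
  set lam : ℝ := κ * n with hlam
  have hlam0 : 0 < lam := by positivity
  set W0 := Wl l0 with hW0
  have hW0c : (W0.card : ℝ) + l0.length = n := by
    have := Wl_card hP
    rw [← hW0] at this
    rw [hn]; exact_mod_cast this
  have hW0n : n / 2 ≤ W0.card := by nlinarith
  have hGW0 : Good G (α / 2) W0 := by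
    rw [hW0, Wl_eq]
    apply good_sdiff (by linarith) hG
    have h1 : ((vs l0).toFinset.card : ℝ) ≤ l0.length := by
      have := List.toFinset_card_le (vs l0)
      rw [vs_length] at this
      exact_mod_cast this
    rw [Finset.card_univ]
    linarith
  set Δ : ℝ := κ * (22 + 2 * r * ζ) / ε + 4 * κ ^ 2 * r ^ 2 / ε ^ 2 with hΔ
  have hΔ0 : 0 ≤ Δ := by positivity
  -- the numerical heart
  have hΔr : Δ ≤ κ * r * (α / 8) := by
    have h1 : 22 ≤ r * ε * (α / 32) := by
      rw [div_le_iff₀ (by positivity)] at ht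
      have : (t : ℝ) * (α * ε) ≤ r * (α * ε) := by gcongr
      linarith
    have h2 : 2 * r * ζ ≤ r * ε * (α / 32) := by nlinarith
    have h3 : κ * (22 + 2 * r * ζ) / ε ≤ κ * r * (α / 16) := by
      rw [div_le_iff₀ hε]
      have := mul_le_mul_of_nonneg_left (add_le_add h1 h2) hκ0.le
      linarith
    have h4 : 4 * κ ^ 2 * r ^ 2 / ε ^ 2 ≤ κ * r * (α / 32) := by
      rw [div_le_iff₀ (by positivity)]
      have := mul_le_mul_of_nonneg_left hκ2 (show 0 ≤ κ * r by positivity)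
      linarith
    have h5 : 0 ≤ κ * r * α := by positivity
    rw [hΔ]; linarith
  have hphi0 : Phi G lam W0 ≤ Real.exp (lam * (1 / 3 - α / 2 + α / 8)) := by
    have h1 := phi_of_good G lam (α / 2) W0 hlam0 (by
      have : (0 : ℝ) < W0.card := by linarith
      exact_mod_cast this) hGW0
    refine h1.trans ?_
    have h2 := hN1 _ hV1
    rw [← hn] at h2
    have h3 : (Fintype.card (V × C) : ℝ) ≤ Real.exp (κ * α / 8 * n) := by
      refine le_trans ?_ h2
      rw [Fintype.card_prod, hCV]; push_cast; rw [← hn]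
      nlinarith [mul_pos hn0 hn0, mul_nonneg (mul_pos hn0 hn0).le (sub_nonneg.mpr hn1)]
    have h4 : Real.exp (lam * (1 / 3 - α / 2 + α / 8)) =
        Real.exp (κ * α / 8 * n) * Real.exp (lam * (1 / 3 - α / 2)) := by
      rw [← Real.exp_add]; congr 1; rw [hlam]; ring
    rw [h4]
    gcongr
  have hgood : ∀ (j : ℕ) (m : List (Tok V C)), (j * r : ℝ) ≤ n → 0 < (Wl (l0 ++ m)).card →
      Phi G lam (Wl (l0 ++ m)) ≤ Phi G lam W0 * Real.exp (j * Δ) →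
      Good G (α / 4) (Wl (l0 ++ m)) := by
    intro j m hj hpos hphi
    apply good_of_phi G lam (α / 4) _ hlam0 hpos
    refine hphi.trans ?_
    have h1 : (j : ℝ) * Δ ≤ lam * (α / 8) := by
      have := mul_le_mul_of_nonneg_left hΔr (Nat.cast_nonneg j : (0:ℝ) ≤ j)
      have h2 := mul_le_mul_of_nonneg_left hj (show 0 ≤ κ * (α / 8) by positivity)
      rw [hlam]; linarith
    calc Phi G lam W0 * Real.exp (j * Δ)
        ≤ Real.exp (lam * (1 / 3 - α / 2 + α / 8)) * Real.exp (lam * (α / 8)) := by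
          gcongr
      _ = Real.exp (lam * (1 / 3 - α / 4)) := by rw [← Real.exp_add]; congr 1; ring
  have hiter : ∀ j : ℕ, (j * r : ℝ) + ε / 2 * n ≤ W0.card → ∃ m : List (Tok V C),
      RPath G (l0 ++ m) ∧ ((Wl (l0 ++ m)).card : ℝ) + j * r = W0.card ∧
      Phi G lam (Wl (l0 ++ m)) ≤ Phi G lam W0 * Real.exp (j * Δ) := by
    intro j
    induction j with
    | zero =>
      intro _
      refine ⟨[], by simpa using hP, by simp [hW0], by simp [hW0]⟩
    | succ j ih =>
      intro hj
      push_cast at hj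
      obtain ⟨m, m1, m2, m3⟩ := ih (by nlinarith)
      have hWm : ε / 2 * n + r ≤ (Wl (l0 ++ m)).card := by linarith
      have hl0 : (0 : ℝ) ≤ l0.length := by positivity
      have hgm := hgood j m (by nlinarith) (by
        have : (0 : ℝ) < (Wl (l0 ++ m)).card := by nlinarith
        exact_mod_cast this) m3
      obtain ⟨l, ρ, σ, hl⟩ := last_two (l0 ++ m) (by simp; omega)
      rw [hl] at m1 m2 m3 hWm hgm
      obtain ⟨ts, t1, t2, t3⟩ := hN0 V C G l ρ σ hCV m1 hV0 (by linarith) hgm lam hlam0.le (by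
        rw [hlam]; nlinarith)
      have c1 := Wl_card m1
      have c2 := Wl_card t2
      rw [List.length_append, t1] at c2
      have c3 : (Wl (l ++ [ρ, σ] ++ ts)).card + r = (Wl (l ++ [ρ, σ])).card := by omega
      have c3' : ((Wl (l ++ [ρ, σ] ++ ts)).card : ℝ) + r = (Wl (l ++ [ρ, σ])).card := by
        exact_mod_cast c3
      have c4 : ε / 2 * n ≤ ((Wl (l ++ [ρ, σ] ++ ts)).card : ℝ) := by linarith
      refine ⟨m ++ ts, ?_, ?_, ?_⟩
      · rw [← List.append_assoc, hl]; exact t2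
      · rw [← List.append_assoc, hl]; push_cast; linarith
      · rw [← List.append_assoc, hl]
        refine t3.trans ?_
        set N' : ℝ := ((Wl (l ++ [ρ, σ] ++ ts)).card : ℝ) with hN'
        have hεn : 0 < ε / 2 * n := by positivity
        have e1 : lam * ((11 + r * ζ) / N') ≤ κ * (22 + 2 * r * ζ) / ε := by
          calc lam * ((11 + r * ζ) / N') ≤ lam * ((11 + r * ζ) / (ε / 2 * n)) := by gcongr
            _ = κ * (22 + 2 * r * ζ) / ε := by rw [hlam]; field_simp; ring
        have e2 : (lam * r / N') ^ 2 ≤ 4 * κ ^ 2 * r ^ 2 / ε ^ 2 := by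
          calc (lam * r / N') ^ 2 ≤ (lam * r / (ε / 2 * n)) ^ 2 := by gcongr
            _ = 4 * κ ^ 2 * r ^ 2 / ε ^ 2 := by rw [hlam]; field_simp; ring
        have e3 : 1 + lam * ((11 + r * ζ) / N') + (lam * r / N') ^ 2 ≤ Real.exp Δ := by
          have := Real.add_one_le_exp Δ
          linarith
        have e4 : Real.exp (((j + 1 : ℕ) : ℝ) * Δ) = Real.exp (j * Δ) * Real.exp Δ := by
          rw [← Real.exp_add]; congr 1; push_cast; ring
        rw [e4, ← mul_assoc]
        have hpn : 0 ≤ Phi G lam W0 :=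
          Finset.sum_nonneg (fun i _ => (Real.exp_pos _).le)
        exact mul_le_mul m3 e3 (by positivity) (by positivity)
  set J := ⌊(W0.card - ε / 2 * n) / r⌋₊ with hJ
  have hq0 : 0 ≤ (W0.card - ε / 2 * n) / r := div_nonneg (by nlinarith) hr0.le
  have hJ1 : (J : ℝ) * r ≤ W0.card - ε / 2 * n := by
    have := Nat.floor_le hq0
    rwa [le_div_iff₀ hr0] at this
  have hJ2 : W0.card - ε / 2 * n < (J + 1) * r := by
    have := Nat.lt_floor_add_one ((W0.card - ε / 2 * n) / r)
    rwa [div_lt_iff₀ hr0] at this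
  obtain ⟨m, m1, m2, m3⟩ := hiter J (by linarith)
  have hl0 : (0 : ℝ) ≤ l0.length := by positivity
  have hεn : 0 < ε / 2 * n := by positivity
  refine ⟨m, m1, hgood J m (by linarith) ?_ m3, by linarith, by linarith⟩
  have : (0 : ℝ) < (Wl (l0 ++ m)).card := by linarith
  exact_mod_cast this

end Posa


namespace Posa

lemma not_mem_vs {V C : Type} [Fintype V] {l : List (Tok V C)} {x : V} (h : x ∈ Wl l) :
    x ∉ vs l := by
  unfold Wl at h
  exact (Finset.mem_filter.mp h).2

lemma not_mem_cs {V C : Type} [Fintype C] {l : List (Tok V C)} {x : C} (h : x ∈ Dl l) :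
    x ∉ cs l := by
  unfold Dl at h
  exact (Finset.mem_filter.mp h).2

lemma Wl_card_le {V C : Type} [Fintype V] (l m : List (Tok V C)) :
    (Wl (l ++ m)).card ≤ (Wl l).card := by
  rw [Wl_append]
  exact Finset.card_le_card Finset.sdiff_subset

lemma pair_up {V C : Type} : ∀ (ws : List V) (ds : List C), ds.length = 2 * ws.length →
    ∃ ξs : List (Tok V C), vs ξs = ws ∧ cs ξs = ds := by
  intro ws
  induction ws with
  | nil =>
    intro ds h
    have : ds = [] := List.length_eq_zero_iff.mp (by simpa using h)
    exact ⟨[], by simp, by simp [this]⟩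
  | cons w ws ih =>
    intro ds h
    match ds, h with
    | [], h => simp at h
    | [_], h => simp at h; omega
    | c :: d :: ds, h =>
      obtain ⟨ξs, h1, h2⟩ := ih ds (by simp at h; omega)
      exact ⟨(w, c, d) :: ξs, by simp [h1], by simp [h2]⟩

end Posa

open Posa in
/-- Theorem 5.1 (thm:posa_rb, rainbow version of Pósa's conjecture): any collection of
`2n` graphs on `[n]`, each of minimum degree at least `(2/3 + α)n`, contains a transversal
copy of the square of a Hamilton cycle. -/
theorem stmt_11 (α : ℝ) (hα : 0 < α) :
    ∃ n₀ : ℕ, ∀ n : ℕ, n₀ ≤ n →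
      ∀ G : Fin (2 * n) → SimpleGraph (Fin n),
        (∀ j : Fin (2 * n), ∀ v : Fin n,
          (2 / 3 + α) * n ≤ ((Finset.univ.filter (fun u => (G j).Adj v u)).card : ℝ)) →
        ∃ (σ : ℕ → Fin n) (φ : ℕ × Bool → Fin (2 * n)),
          Set.BijOn σ {i | i < n} Set.univ ∧
          Set.BijOn φ {p | p.1 < n} Set.univ ∧
          ∀ i < n,
            (G (φ (i, false))).Adj (σ i) (σ ((i + 1) % n)) ∧
            (G (φ (i, true))).Adj (σ i) (σ ((i + 2) % n)) := by
  obtain ⟨ε0, hε0, N1, h1⟩ := phase1 α hα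
  set ε := min ε0 (1 / 2) with hεdef
  have hε : 0 < ε := by rw [hεdef]; positivity
  have hεle : ε ≤ ε0 := min_le_left _ _
  obtain ⟨N2, h2⟩ := phase2 α ε hα hε (min_le_right _ _)
  obtain ⟨N3, h3⟩ := close (α / 4) (ε / 2) (by linarith) (by linarith)
  refine ⟨max N1 (max N2 (max N3 3)), ?_⟩
  intro n hn G hG
  simp only [max_le_iff] at hn
  obtain ⟨hn1, hn2, hn3, hn4⟩ := hn
  have hcV : Fintype.card (Fin n) = n := Fintype.card_fin n
  have hcC : Fintype.card (Fin (2 * n)) = 2 * Fintype.card (Fin n) := by simp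
  have hGood : Good G α Finset.univ := by
    intro c v
    rw [Finset.card_univ, hcV]
    convert hG c v
  obtain ⟨τ1, τ2, B, h12, hP, hB2, hBlen, habs⟩ := h1 (Fin n) (Fin (2 * n)) G hcC
    (by rw [hcV]; exact hn1) hGood
  obtain ⟨m, m1, m2, m3, m4⟩ := h2 (Fin n) (Fin (2 * n)) G _ hcC (by rw [hcV]; exact hn2) hGood hP
    (by simp) hBlen
  obtain ⟨l, ρ, σ, hl⟩ := last_two (B.flatten ++ m) (by rw [List.length_append]; omega)
  have hl' : τ1 :: τ2 :: B.flatten ++ m = τ1 :: τ2 :: l ++ [ρ, σ] := by simp [hl]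
  have hWl := hl'
  rw [hl'] at m1 m2 m3 m4
  obtain ⟨ts, t1, t2⟩ := h3 (Fin n) (Fin (2 * n)) G l τ1 τ2 ρ σ hcC m1 h12
    (by rw [hcV]; exact hn3) m3 m2
  have hWle : (Wl (τ1 :: τ2 :: l ++ [ρ, σ] ++ ts)).card ≤ (Wl (τ1 :: τ2 :: l ++ [ρ, σ])).card :=
    Wl_card_le _ _
  rw [← hl'] at t1 t2 hWle m4
  set P := τ1 :: τ2 :: B.flatten ++ m ++ ts with hPdef
  have cW := Wl_card t1
  have cD := Dl_card t1
  obtain ⟨ξs, x1, x2⟩ := pair_up (Wl P).toList (Dl P).toList (by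
    rw [Finset.length_toList, Finset.length_toList]; omega)
  have hξlen : ξs.length = (Wl P).card := by
    rw [← vs_length ξs, x1, Finset.length_toList]
  obtain ⟨L, v1, v2, v3⟩ := absorb_all G [τ1, τ2] (m ++ ts ++ [τ1, τ2]) ξs B (by
    simpa [hPdef] using t2) (by
    intro ξ _
    have k1 := habs ξ
    have k2 : ((ξs.length : ℕ) : ℝ) ≤ B.countP (fun b => decide (IsAbs G ξ b)) := by
      rw [hξlen]
      have k3 : ((Wl P).card : ℝ) ≤ (Wl (τ1 :: τ2 :: B.flatten ++ m)).card := by exact_mod_cast hWle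
      refine (k3.trans m4).trans (le_trans ?_ k1)
      gcongr
    exact_mod_cast k2)
  have pv : (vs (τ1 :: τ2 :: (L ++ m ++ ts))).Perm (vs P ++ (Wl P).toList) := by
    rw [List.perm_iff_count]
    intro x
    have := v2.count_eq x
    rw [x1] at this
    simp only [hPdef, vs_cons, vs_append, List.cons_append, List.count_append, List.count_cons] at this ⊢
    omega
  have pc : (cs (τ1 :: τ2 :: (L ++ m ++ ts))).Perm (cs P ++ (Dl P).toList) := by
    rw [List.perm_iff_count]
    intro x
    have := v3.count_eq x
    rw [x2] at this
    simp only [hPdef, cs_cons, cs_append, List.cons_append, List.count_append, List.count_cons] at this ⊢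
    omega
  refine extract n hn4 G τ1 τ2 (L ++ m ++ ts) ?_ ?_ ?_ ?_
  · rw [← vs_length, pv.length_eq, List.length_append, vs_length, Finset.length_toList]
    omega
  · rw [pv.nodup_iff, List.nodup_append']
    refine ⟨t1.2.1, Finset.nodup_toList _, fun x hx hx' => ?_⟩
    rw [Finset.mem_toList] at hx'
    exact not_mem_vs hx' hx
  · rw [pc.nodup_iff, List.nodup_append']
    refine ⟨t1.2.2, Finset.nodup_toList _, fun x hx hx' => ?_⟩
    rw [Finset.mem_toList] at hx'
    exact not_mem_cs hx' hx
  · simpa using v1
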